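/- Let G be the group presented on generators a, b, c, d with relators a², b², c², d², (ab)⁵, (bc)³, (cd)⁵, (ac)², (ad)², (bd)² and (bcd)⁵. Then G has order 600415200. -/

import Mathlib

namespace Stmt15

/-- The generators `a`, `b`, `c`, `d` of the free group on four letters. -/
def a : FreeGroup (Fin 4) := FreeGroup.of 0
def b : FreeGroup (Fin 4) := FreeGroup.of 1
def c : FreeGroup (Fin 4) := FreeGroup.of 2
def d : FreeGroup (Fin 4) := FreeGroup.of 3

/-- Relators for the Coxeter group `[5,3,5]` together with the Petrie relator `(bcd)⁵`. -/
def rels : Set (FreeGroup (Fin 4)) :=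
  {a ^ 2, b ^ 2, c ^ 2, d ^ 2, (a * b) ^ 5, (b * c) ^ 3, (c * d) ^ 5,
    (a * c) ^ 2, (a * d) ^ 2, (b * d) ^ 2, (b * c * d) ^ 5}

/-- The group presented by the above relators. -/
abbrev G := PresentedGroup rels

/-- The images of the generators in `G`. -/
def ga : G := PresentedGroup.of 0
def gb : G := PresentedGroup.of 1
def gc : G := PresentedGroup.of 2
def gd : G := PresentedGroup.of 3

/-! ### Packed coset tables

A partial coset table is packed into a single natural number: the entry of node `s` for the
generator `x` occupies `w` bits, is `0` when undefined, and is `v + 1` when it leads to the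
node `v`. The functions are written with recursors and in continuation-passing style so that the
kernel evaluates them quickly. -/

/-- Evaluate a continuation at a number; the kernel passes on a numeral instead of a thunk. -/
noncomputable def force (n : ℕ) (f : ℕ → Bool) : Bool :=
  Nat.rec (f 0) (fun m _ => f m) (Nat.add n 1)

/-- Conjunction that evaluates its second argument only if needed. -/
noncomputable def guardB (b r : Bool) : Bool := Bool.rec false r b

/-- A word `u x v⁻¹` in the generators, required to be trivial or, if `atBase` is set, to lie in
the subgroup whose cosets are enumerated. -/
structure Rule where
  u : List ℕ
  x : ℕ
  v : List ℕ
  atBase : Bool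

/-- The entry of the packed table `T` for node `s` and generator `x`. -/
noncomputable def entry (ng w T s x : ℕ) : ℕ :=
  Nat.mod (Nat.shiftRight T (Nat.mul w (Nat.add (Nat.mul s ng) x))) (Nat.pow 2 w)

/-- The table whose only entry leads from `s` to `v` along `x`. -/
noncomputable def slot (ng w s x v : ℕ) : ℕ :=
  Nat.shiftLeft (Nat.add v 1) (Nat.mul w (Nat.add (Nat.mul s ng) x))

/-- Follow a word through the table. -/
noncomputable def traceK (ng w T : ℕ) (l : List ℕ) (f : ℕ → Bool) : ℕ → Bool :=
  List.rec (motive := fun _ => ℕ → Bool) f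
    (fun x _ ih s => Nat.rec false (fun m _ => ih m) (entry ng w T s x)) l

/-- Join `p` and `q` by an edge labelled with the involution `x`. -/
noncomputable def linkK (ng w p x q T : ℕ) (f : ℕ → Bool) : Bool :=
  guardB (Nat.ble (Nat.add x 1) ng) <| guardB (Nat.ble (Nat.add p 2) (Nat.pow 2 w)) <|
  guardB (Nat.ble (Nat.add q 2) (Nat.pow 2 w)) <|
  guardB (Nat.beq (entry ng w T p x) 0) <| guardB (Nat.beq (entry ng w T q x) 0) <|
  force (Nat.lor T (Nat.lor (slot ng w p x q) (slot ng w q x p))) f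

/-- Deduce the missing edge of a rule read from node `s`. -/
noncomputable def deduceK (ng w m s : ℕ) (R : Rule) (T : ℕ) (f : ℕ → Bool) : Bool :=
  Rule.rec (fun u x v b => force (Bool.rec s 0 b) fun s =>
    guardB (Nat.ble (Nat.add s 1) m) <|
      traceK ng w T u (fun p => traceK ng w T v (fun q => linkK ng w p x q T f) s) s) R

/-- Carry out the node definitions encoded in the digits of a number: the digit
`s * G + x + 1` in base `B` introduces a new node joined to `s` by `x`. -/
noncomputable def defineDigitsK (ng w B G fuel : ℕ) :
    ℕ → ℕ → ℕ → (ℕ → ℕ → Bool) → Bool :=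
  Nat.rec (motive := fun _ => ℕ → ℕ → ℕ → (ℕ → ℕ → Bool) → Bool)
    (fun _ m T f => f m T)
    (fun _ ih n m T f => Bool.rec
      (force (Nat.sub (Nat.mod n B) 1) fun k => force (Nat.div k G) fun s =>
        guardB (Nat.ble (Nat.add s 1) m) (linkK ng w s (Nat.mod k G) m T fun T' =>
          force (Nat.add m 1) fun m' => force (Nat.div n B) fun n' => ih n' m' T' f))
      (f m T) (Nat.beq n 0)) fuel

/-- Carry out all node definitions of a script. -/
noncomputable def defineK (ng w B G fuel : ℕ) (l : List ℕ) : ℕ → ℕ → (ℕ → ℕ → Bool) → Bool :=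
  List.rec (motive := fun _ => ℕ → ℕ → (ℕ → ℕ → Bool) → Bool)
    (fun m T f => f m T)
    (fun n _ ih m T f => defineDigitsK ng w B G fuel n m T fun m' T' => ih m' T' f) l

/-- Evaluate a continuation at an entry of a list. -/
noncomputable def nthK {α : Type} (l : List α) : ℕ → (α → Bool) → Bool :=
  List.rec (motive := fun _ => ℕ → (α → Bool) → Bool) (fun _ _ => false)
    (fun a _ ih n f => Nat.rec (f a) (fun m _ => ih m f) n) l

/-- Carry out the deductions encoded in the digits of a number: the digit `s * G + r + 1` in base
`B` applies the rule number `r` at node `s`, where `look` finds the rules by their numbers. -/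
noncomputable def deduceDigitsK (ng w m : ℕ) (look : ℕ → (Rule → Bool) → Bool) (B G fuel : ℕ) :
    ℕ → ℕ → (ℕ → Bool) → Bool :=
  Nat.rec (motive := fun _ => ℕ → ℕ → (ℕ → Bool) → Bool)
    (fun _ T f => f T)
    (fun _ ih n T f => Bool.rec
      (force (Nat.sub (Nat.mod n B) 1) fun k =>
        look (Nat.mod k G) fun R => force (Nat.div k G) fun s => deduceK ng w m s R T fun T' =>
          force (Nat.div n B) fun n' => ih n' T' f)
      (f T) (Nat.beq n 0)) fuel

/-- Carry out all deductions of a script. -/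
noncomputable def deduceAllK (ng w m : ℕ) (look : ℕ → (Rule → Bool) → Bool) (B G fuel : ℕ)
    (l : List ℕ) : ℕ → (ℕ → Bool) → Bool :=
  List.rec (motive := fun _ => ℕ → (ℕ → Bool) → Bool)
    (fun T f => f T)
    (fun n _ ih T f => deduceDigitsK ng w m look B G fuel n T fun T' => ih T' f) l

/-- A coset enumeration: the number of generators, the width of the entries, and packed lists of
node definitions and of deductions. -/
structure Script where
  ng : ℕ
  w : ℕ
  defBase : ℕ
  defSplit : ℕ
  defs : List ℕ
  dedBase : ℕ
  dedSplit : ℕ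
  deds : List ℕ

/-- Run a script and test the number of nodes and the table it produces. -/
noncomputable def Script.run (S : Script) (look : ℕ → (Rule → Bool) → Bool) (f : ℕ → ℕ → Bool) :
    Bool :=
  Script.rec (fun ng w B G ds B' G' es => defineK ng w B G 100 ds 1 0 fun m T =>
    deduceAllK ng w m look B' G' 100 es T fun T' => f m T') S

/-- Do all words of the list lead from the base node to itself? -/
noncomputable def closedK (ng w T : ℕ) (ls : List (List ℕ)) : Bool :=
  List.rec (motive := fun _ => Bool) true
    (fun l _ ih => traceK ng w T l (fun s => Nat.rec ih (fun _ _ => false) s) 0) ls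

/-- Are the entries of node `s` defined for all generators of a list? -/
noncomputable def rowK (ng w T s : ℕ) (ys : List ℕ) (r : Bool) : Bool :=
  List.rec (motive := fun _ => Bool) r
    (fun y _ ih => Nat.rec false (fun _ _ => ih) (entry ng w T s y)) ys

/-- Are the entries of the nodes below `n` defined for all generators of a list? -/
noncomputable def completeK (ng w T : ℕ) (ys : List ℕ) (n : ℕ) : Bool :=
  Nat.rec (motive := fun _ => Bool) true (fun s ih => rowK ng w T s ys ih) n

section Soundness

variable {Γ : Type*} [Group Γ]

/-- The value of a word. -/
def wordVal (g : ℕ → Γ) (l : List ℕ) : Γ := (l.map g).prod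

@[simp] lemma wordVal_nil (g : ℕ → Γ) : wordVal g [] = 1 := rfl

@[simp] lemma wordVal_cons (g : ℕ → Γ) (x : ℕ) (l : List ℕ) :
    wordVal g (x :: l) = g x * wordVal g l := by simp [wordVal]

lemma wordVal_append (g : ℕ → Γ) (l l' : List ℕ) :
    wordVal g (l ++ l') = wordVal g l * wordVal g l' := by simp [wordVal]

/-- The rule holds for the generators `g` and the subgroup `K`. -/
def Rule.Valid (g : ℕ → Γ) (K : Subgroup Γ) (ng : ℕ) (R : Rule) : Prop :=
  (∀ x ∈ R.u, x < ng) ∧ (∀ x ∈ R.v, x < ng) ∧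
    (if R.atBase then wordVal g R.u * g R.x * (wordVal g R.v)⁻¹ ∈ K
      else wordVal g R.u * g R.x * (wordVal g R.v)⁻¹ = 1)

/-- Every rule found by `look` holds. -/
def IsLookup (g : ℕ → Γ) (K : Subgroup Γ) (ng : ℕ) (look : ℕ → (Rule → Bool) → Bool) : Prop :=
  ∀ n f, look n f = true → ∃ R : Rule, R.Valid g K ng ∧ f R = true

/-- The table `T` on `m` nodes describes the cosets `K * t s`. -/
structure IsTable (g : ℕ → Γ) (K : Subgroup Γ) (ng w : ℕ) (t : ℕ → Γ) (m T : ℕ) : Prop where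
  base : t 0 = 1
  pos : 0 < m
  edge : ∀ s x v, x < ng → entry ng w T s x = v + 1 →
    s < m ∧ v < m ∧ t s * g x * (t v)⁻¹ ∈ K

lemma force_eq (n : ℕ) (f : ℕ → Bool) : force n f = f n := rfl

lemma guardB_iff {b r : Bool} : guardB b r = true ↔ b = true ∧ r = true := by
  cases b <;> simp [guardB]

lemma entry_eq (ng w T s x : ℕ) : entry ng w T s x = (T >>> (w * (s * ng + x))) % 2 ^ w := rfl

lemma slot_eq (ng w s x v : ℕ) : slot ng w s x v = (v + 1) <<< (w * (s * ng + x)) := rfl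

lemma entry_lor (ng w T U s x : ℕ) :
    entry ng w (T ||| U) s x = entry ng w T s x ||| entry ng w U s x := by
  simp only [entry_eq]
  apply Nat.eq_of_testBit_eq
  intro i
  simp only [Nat.testBit_mod_two_pow, Nat.testBit_shiftRight, Nat.testBit_or]
  cases decide (i < w) <;> simp

lemma index_inj {ng s x s' x' : ℕ} (hx : x < ng) (hx' : x' < ng)
    (h : s * ng + x = s' * ng + x') : s = s' ∧ x = x' := by
  have h1 : (x + ng * s) / ng = (x' + ng * s') / ng := by
    rw [mul_comm ng s, mul_comm ng s', add_comm x, add_comm x', h]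
  rw [Nat.add_mul_div_left _ _ (by omega), Nat.add_mul_div_left _ _ (by omega),
    Nat.div_eq_of_lt hx, Nat.div_eq_of_lt hx'] at h1
  have h2 : s = s' := by omega
  subst h2
  exact ⟨rfl, by omega⟩

lemma entry_slot {ng w p x v s y : ℕ} (hx : x < ng) (hy : y < ng) (hv : v + 2 ≤ 2 ^ w) :
    entry ng w (slot ng w p x v) s y = if s = p ∧ y = x then v + 1 else 0 := by
  rw [entry_eq, slot_eq]
  split_ifs with h
  · obtain ⟨rfl, rfl⟩ := h
    rw [Nat.shiftLeft_shiftRight, Nat.mod_eq_of_lt (by omega)]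
  · have hne : s * ng + y ≠ p * ng + x := fun e => h (index_inj hy hx e)
    apply Nat.eq_of_testBit_eq
    intro i
    simp only [Nat.testBit_mod_two_pow, Nat.testBit_shiftRight, Nat.testBit_shiftLeft,
      Nat.zero_testBit, Bool.and_eq_false_iff, decide_eq_false_iff_not]
    by_cases hi : i < w
    · right
      rcases lt_or_gt_of_ne hne with hlt | hlt
      · left
        have : w * (s * ng + y + 1) ≤ w * (p * ng + x) := Nat.mul_le_mul_left _ hlt
        rw [mul_add] at this
        omega
      · right
        have : w * (p * ng + x + 1) ≤ w * (s * ng + y) := Nat.mul_le_mul_left _ hlt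
        rw [mul_add] at this
        apply Nat.testBit_lt_two_pow
        calc v + 1 < 2 ^ w := by omega
          _ ≤ _ := Nat.pow_le_pow_right (by norm_num) (by omega)
    · exact Or.inl hi

lemma IsTable.trace {g : ℕ → Γ} {K : Subgroup Γ} {ng w : ℕ} {t : ℕ → Γ} {m T : ℕ}
    (h : IsTable g K ng w t m T) {f : ℕ → Bool} :
    ∀ {l : List ℕ} {s : ℕ}, (∀ x ∈ l, x < ng) → traceK ng w T l f s = true →
      ∃ s', f s' = true ∧ t s * wordVal g l * (t s')⁻¹ ∈ K ∧ (s < m → s' < m)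
  | [], s, _, hf => ⟨s, hf, by simp, id⟩
  | x :: l, s, hl, hf => by
    have hx : x < ng := hl x (by simp)
    have hf' : (Nat.rec false (fun m _ => traceK ng w T l f m) (entry ng w T s x) : Bool)
      = true := hf
    rcases he : entry ng w T s x with _ | v
    · rw [he] at hf'; simp at hf'
    · rw [he] at hf'
      obtain ⟨h1, h2, h3⟩ := h.edge s x v hx he
      obtain ⟨s', hs', hm, hlt⟩ := h.trace (l := l) (s := v) (fun y hy => hl y (by simp [hy])) hf'
      refine ⟨s', hs', ?_, fun _ => hlt h2⟩
      have := K.mul_mem h3 hm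
      rw [wordVal_cons]
      convert this using 1
      group

lemma linkK_spec {ng w p x q T : ℕ} {f : ℕ → Bool} (h : linkK ng w p x q T f = true) :
    ∃ T', f T' = true ∧ x < ng ∧ ∀ s y v, y < ng → entry ng w T' s y = v + 1 →
      entry ng w T s y = v + 1 ∨ (s = p ∧ y = x ∧ v = q) ∨ (s = q ∧ y = x ∧ v = p) := by
  simp only [linkK, guardB_iff, force_eq, Nat.ble_eq] at h
  obtain ⟨hx, hp, hq, ep, eq, hf⟩ := h
  change x + 1 ≤ ng at hx
  change p + 2 ≤ 2 ^ w at hp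
  change q + 2 ≤ 2 ^ w at hq
  replace ep : entry ng w T p x = 0 := Nat.eq_of_beq_eq_true ep
  replace eq : entry ng w T q x = 0 := Nat.eq_of_beq_eq_true eq
  refine ⟨_, hf, hx, fun s y v hy he => ?_⟩
  change entry ng w (T ||| (slot ng w p x q ||| slot ng w q x p)) s y = v + 1 at he
  rw [entry_lor, entry_lor, entry_slot hx hy hq, entry_slot hx hy hp] at he
  by_cases h1 : s = p ∧ y = x
  · obtain ⟨rfl, rfl⟩ := h1
    rw [ep] at he
    by_cases h2 : s = q
    · subst h2; simp at he; simp [he]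
    · simp [h2] at he; simp [he]
  · by_cases h2 : s = q ∧ y = x
    · obtain ⟨rfl, rfl⟩ := h2
      rw [eq] at he
      have hsp : s ≠ p := fun e => h1 ⟨e, rfl⟩
      simp [hsp] at he; simp [he]
    · simp [h1, h2] at he; simp [he]

lemma IsTable.link {g : ℕ → Γ} (hg : ∀ x, g x * g x = 1) {K : Subgroup Γ} {ng w : ℕ}
    {t : ℕ → Γ} {m T p x q : ℕ} (h : IsTable g K ng w t m T) (hp : p < m) (hq : q < m)
    (hK : t p * g x * (t q)⁻¹ ∈ K) {f : ℕ → Bool} (hf : linkK ng w p x q T f = true) :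
    ∃ T', f T' = true ∧ IsTable g K ng w t m T' := by
  obtain ⟨T', hf', -, he⟩ := linkK_spec hf
  refine ⟨T', hf', h.base, h.pos, fun s y v hy hv => ?_⟩
  rcases he s y v hy hv with h1 | ⟨rfl, rfl, rfl⟩ | ⟨rfl, rfl, rfl⟩
  · exact h.edge s y v hy h1
  · exact ⟨hp, hq, hK⟩
  · refine ⟨hq, hp, ?_⟩
    have := K.inv_mem hK
    have hinv : (g y)⁻¹ = g y := inv_eq_of_mul_eq_one_left (hg y)
    simpa [mul_assoc, hinv] using this

lemma IsTable.define {g : ℕ → Γ} (hg : ∀ x, g x * g x = 1) {K : Subgroup Γ} {ng w : ℕ}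
    {t : ℕ → Γ} {m T s x : ℕ} (h : IsTable g K ng w t m T) (hs : s < m)
    {f : ℕ → Bool} (hf : linkK ng w s x m T f = true) :
    ∃ t' T', f T' = true ∧ IsTable g K ng w t' (m + 1) T' := by
  have h' : IsTable g K ng w (Function.update t m (t s * g x)) (m + 1) T := by
    refine ⟨?_, by omega, fun s y v hy hv => ?_⟩
    · rw [Function.update_of_ne h.pos.ne, h.base]
    · obtain ⟨h1, h2, h3⟩ := h.edge s y v hy hv
      refine ⟨by omega, by omega, ?_⟩
      rwa [Function.update_of_ne h1.ne, Function.update_of_ne h2.ne]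
  obtain ⟨T', h1, h2⟩ := h'.link hg (p := s) (q := m) (by omega) (by omega)
    (by rw [Function.update_of_ne hs.ne, Function.update_self]; simp) hf
  exact ⟨_, T', h1, h2⟩

lemma IsTable.deduce {g : ℕ → Γ} (hg : ∀ x, g x * g x = 1) {K : Subgroup Γ} {ng w : ℕ}
    {t : ℕ → Γ} {m T s : ℕ} {R : Rule} (h : IsTable g K ng w t m T) (hR : R.Valid g K ng)
    {f : ℕ → Bool} (hf : deduceK ng w m s R T f = true) :
    ∃ T', f T' = true ∧ IsTable g K ng w t m T' := by
  obtain ⟨u, x, v, b⟩ := R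
  obtain ⟨hu, hv, hb⟩ := hR
  obtain ⟨r, hr, hf'⟩ : ∃ r, (b = true → r = 0) ∧ guardB (Nat.ble (Nat.add r 1) m)
      (traceK ng w T u (fun p => traceK ng w T v (fun q => linkK ng w p x q T f) r) r) = true := by
    cases b
    · exact ⟨s, by simp, hf⟩
    · exact ⟨0, by simp, hf⟩
  rw [guardB_iff, Nat.ble_eq] at hf'
  obtain ⟨hrm, hf'⟩ := hf'
  replace hrm : r < m := hrm
  obtain ⟨p, hp, hpK, hpm⟩ := h.trace hu hf'
  obtain ⟨q, hq, hqK, hqm⟩ := h.trace hv hp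
  refine h.link hg (hpm hrm) (hqm hrm) ?_ hq
  have hW : t r * (wordVal g u * g x * (wordVal g v)⁻¹) * (t r)⁻¹ ∈ K := by
    cases b
    · rw [if_neg (by simp)] at hb
      rw [hb]; simp
    · rw [if_pos rfl] at hb
      rw [hr rfl, h.base]
      simpa using hb
  have := K.mul_mem (K.mul_mem (K.inv_mem hpK) hW) hqK
  convert this using 1
  group

lemma IsTable.defineDigits {g : ℕ → Γ} (hg : ∀ x, g x * g x = 1) {K : Subgroup Γ} {ng w B G : ℕ}
    {f : ℕ → ℕ → Bool} (fuel : ℕ) : ∀ {n m T : ℕ} {t : ℕ → Γ}, IsTable g K ng w t m T →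
      defineDigitsK ng w B G fuel n m T f = true →
      ∃ t' m' T', f m' T' = true ∧ IsTable g K ng w t' m' T' := by
  induction fuel with
  | zero => exact fun h hf => ⟨_, _, _, hf, h⟩
  | succ fuel ih =>
    intro n m T t h hf
    change (Bool.rec (force _ fun k => force (k / G) fun s => guardB _ (linkK ng w s (k % G) m T
      fun T' => force (m + 1) fun m' => force (n / B) fun n' =>
        defineDigitsK ng w B G fuel n' m' T' f)) (f m T) (Nat.beq n 0) : Bool) = true at hf
    cases hn : Nat.beq n 0
    · simp only [hn, force_eq, guardB_iff, Nat.ble_eq] at hf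
      obtain ⟨t', T', hf', h'⟩ := h.define hg (by exact hf.1) hf.2
      exact ih h' hf'
    · rw [hn] at hf
      exact ⟨_, _, _, hf, h⟩

lemma IsTable.defineAll {g : ℕ → Γ} (hg : ∀ x, g x * g x = 1) {K : Subgroup Γ} {ng w B G : ℕ}
    {f : ℕ → ℕ → Bool} (fuel : ℕ) : ∀ {l : List ℕ} {m T : ℕ} {t : ℕ → Γ},
      IsTable g K ng w t m T → defineK ng w B G fuel l m T f = true →
      ∃ t' m' T', f m' T' = true ∧ IsTable g K ng w t' m' T'
  | [], _, _, _, h, hf => ⟨_, _, _, hf, h⟩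
  | n :: l, m, T, _, h, hf => by
    obtain ⟨t', m', T', hf', h'⟩ := h.defineDigits hg fuel
      (f := fun m' T' => defineK ng w B G fuel l m' T' f) hf
    exact IsTable.defineAll hg fuel h' hf'

lemma nthK_spec {α : Type} : ∀ {l : List α} {n : ℕ} {f : α → Bool}, nthK l n f = true →
    ∃ a ∈ l, f a = true
  | [], _, _, h => by simp [nthK] at h
  | a :: l, 0, f, h => ⟨a, by simp, h⟩
  | a :: l, n + 1, f, h => by
    obtain ⟨b, hb, hf⟩ := nthK_spec (l := l) (n := n) (f := f) h
    exact ⟨b, by simp [hb], hf⟩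

lemma IsTable.deduceDigits {g : ℕ → Γ} (hg : ∀ x, g x * g x = 1) {K : Subgroup Γ}
    {ng w B G : ℕ} {look : ℕ → (Rule → Bool) → Bool} (hlook : IsLookup g K ng look)
    {m : ℕ} {t : ℕ → Γ} {f : ℕ → Bool} (fuel : ℕ) : ∀ {n T : ℕ}, IsTable g K ng w t m T →
      deduceDigitsK ng w m look B G fuel n T f = true →
      ∃ T', f T' = true ∧ IsTable g K ng w t m T' := by
  induction fuel with
  | zero => exact fun h hf => ⟨_, hf, h⟩
  | succ fuel ih =>
    intro n T h hf
    change (Bool.rec (force _ fun k => look (k % G) fun R =>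
      force (k / G) fun s => deduceK ng w m s R T fun T' => force (n / B) fun n' =>
          deduceDigitsK ng w m look B G fuel n' T' f) (f T) (Nat.beq n 0) : Bool) = true at hf
    cases hn : Nat.beq n 0
    · simp only [hn, force_eq] at hf
      obtain ⟨R, hR, hf⟩ := hlook _ _ hf
      obtain ⟨T', hf', h'⟩ := h.deduce hg hR hf
      exact ih h' hf'
    · rw [hn] at hf
      exact ⟨_, hf, h⟩

lemma IsTable.deduceAll {g : ℕ → Γ} (hg : ∀ x, g x * g x = 1) {K : Subgroup Γ}
    {ng w B G : ℕ} {look : ℕ → (Rule → Bool) → Bool} (hlook : IsLookup g K ng look)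
    {m : ℕ} {t : ℕ → Γ} {f : ℕ → Bool} (fuel : ℕ) : ∀ {l : List ℕ} {T : ℕ},
      IsTable g K ng w t m T → deduceAllK ng w m look B G fuel l T f = true →
      ∃ T', f T' = true ∧ IsTable g K ng w t m T'
  | [], _, h, hf => ⟨_, hf, h⟩
  | n :: l, T, h, hf => by
    obtain ⟨T', hf', h'⟩ := h.deduceDigits hg hlook fuel
      (f := fun T' => deduceAllK ng w m look B G fuel l T' f) hf
    exact IsTable.deduceAll hg hlook fuel h' hf'

lemma Script.run_spec {g : ℕ → Γ} (hg : ∀ x, g x * g x = 1) {K : Subgroup Γ} (S : Script)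
    {look : ℕ → (Rule → Bool) → Bool} (hlook : IsLookup g K S.ng look) {f : ℕ → ℕ → Bool}
    (hf : S.run look f = true) :
    ∃ t m T, f m T = true ∧ IsTable g K S.ng S.w t m T := by
  obtain ⟨ng, w, B, G, ds, B', G', es⟩ := S
  have h0 : IsTable g K ng w (fun _ => 1) 1 0 :=
    ⟨rfl, one_pos, fun s x v _ h => by simp [entry_eq] at h⟩
  obtain ⟨t, m, T, hf', h⟩ := h0.defineAll hg 100
    (f := fun m T => deduceAllK ng w m look B' G' 100 es T fun T' => f m T') hf
  obtain ⟨T', hf'', h'⟩ := h.deduceAll hg hlook 100 hf'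
  exact ⟨t, m, T', hf'', h'⟩

lemma IsTable.closed {g : ℕ → Γ} {K : Subgroup Γ} {ng w : ℕ} {t : ℕ → Γ} {m T : ℕ}
    (h : IsTable g K ng w t m T) : ∀ {ls : List (List ℕ)}, (∀ l ∈ ls, ∀ x ∈ l, x < ng) →
      closedK ng w T ls = true → ∀ l ∈ ls, wordVal g l ∈ K
  | [], _, _ => by simp
  | l :: ls, hl, hf => by
    obtain ⟨s, hs, hK, -⟩ := h.trace (l := l) (s := 0) (hl l (by simp))
      (f := fun s => Nat.rec (motive := fun _ => Bool) (closedK ng w T ls) (fun _ _ => false) s) hf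
    obtain _ | s := s
    · intro l' hl'
      rcases List.mem_cons.1 hl' with rfl | hl'
      · simpa [h.base] using hK
      · exact h.closed (fun l hl' => hl l (by simp [hl'])) hs l' hl'
    · simp at hs

lemma rowK_spec {ng w T s : ℕ} {r : Bool} : ∀ {ys : List ℕ}, rowK ng w T s ys r = true →
    r = true ∧ ∀ y ∈ ys, entry ng w T s y ≠ 0
  | [], h => ⟨h, by simp⟩
  | y :: ys, h => by
    change (Nat.rec false (fun _ _ => rowK ng w T s ys r) (entry ng w T s y) : Bool) = true at h
    rcases he : entry ng w T s y with _ | v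
    · rw [he] at h; simp at h
    · rw [he] at h
      obtain ⟨h1, h2⟩ := rowK_spec (ys := ys) h
      refine ⟨h1, fun y' hy' => ?_⟩
      rcases List.mem_cons.1 hy' with rfl | hy'
      · simp [he]
      · exact h2 y' hy'

lemma completeK_spec {ng w T : ℕ} {ys : List ℕ} {n : ℕ} (h : completeK ng w T ys n = true) :
    ∀ s < n, ∀ y ∈ ys, entry ng w T s y ≠ 0 := by
  induction n with
  | zero => simp
  | succ n ih =>
    obtain ⟨h1, h2⟩ := rowK_spec (show rowK ng w T n ys (completeK ng w T ys n) = true from h)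
    intro s hs
    rcases Nat.lt_succ_iff_lt_or_eq.1 hs with hs | rfl
    · exact ih h1 s hs
    · exact h2

lemma IsTable.cover {g : ℕ → Γ} (hg : ∀ x, g x * g x = 1) {K : Subgroup Γ} {ng w : ℕ}
    {t : ℕ → Γ} {m T : ℕ} (h : IsTable g K ng w t m T) {ys : List ℕ} (hys : ∀ y ∈ ys, y < ng)
    (hc : completeK ng w T ys m = true) :
    ∀ a ∈ Subgroup.closure (g '' {y | y ∈ ys}), ∃ s < m, a * (t s)⁻¹ ∈ K := by
  have hstep : ∀ y ∈ ys, ∀ a, (∃ s < m, a * (t s)⁻¹ ∈ K) → ∃ s < m, a * g y * (t s)⁻¹ ∈ K := by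
    rintro y hy a ⟨s, hs, ha⟩
    obtain ⟨v, hv⟩ := Nat.exists_eq_succ_of_ne_zero (completeK_spec hc s hs y hy)
    obtain ⟨-, h2, h3⟩ := h.edge s y v (hys y hy) hv
    refine ⟨v, h2, ?_⟩
    have := K.mul_mem ha h3
    convert this using 1
    group
  intro a ha
  induction ha using Subgroup.closure_induction_right with
  | one => exact ⟨0, h.pos, by simp [h.base]⟩
  | mul_right a y _ hy ih =>
    obtain ⟨y, hy, rfl⟩ := hy
    exact hstep y hy a ih
  | mul_inv_cancel a y _ hy ih =>
    obtain ⟨y, hy, rfl⟩ := hy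
    rw [inv_eq_of_mul_eq_one_left (hg y)]
    exact hstep y hy a ih

/-- If `H` is covered by `m` cosets of `K`, then `|H| ≤ m |K|`. -/
lemma card_le_of_cover {H K : Subgroup Γ} {m k : ℕ} {t : ℕ → Γ}
    (h : ∀ a ∈ H, ∃ s < m, a * (t s)⁻¹ ∈ K) (hK : Finite K ∧ Nat.card K ≤ k) :
    Finite H ∧ Nat.card H ≤ m * k := by
  have := hK.1
  choose! s hs hsK using h
  let F : H → Fin m × K := fun a => (⟨s a, hs a a.2⟩, ⟨a * (t (s a))⁻¹, hsK a a.2⟩)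
  have hF : Function.Injective F := by
    intro a b hab
    simp only [F, Prod.mk.injEq, Fin.mk.injEq, Subtype.mk.injEq] at hab
    obtain ⟨h1, h2⟩ := hab
    rw [h1] at h2
    exact Subtype.ext (mul_right_cancel h2)
  refine ⟨Finite.of_injective F hF, (Nat.card_le_card_of_injective F hF).trans ?_⟩
  rw [Nat.card_prod, Nat.card_fin]
  exact Nat.mul_le_mul_left _ hK.2

end Soundness
section Rules

variable {Γ : Type*} [Group Γ]

/-- Find a rule by its number in a list of lists of 32 rules. -/
noncomputable def lookRules (rs : List (List Rule)) (n : ℕ) (f : Rule → Bool) : Bool :=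
  nthK rs (Nat.div n 32) fun l => nthK l (Nat.mod n 32) f

/-- The word that a rule makes trivial, when the generators are involutions. -/
def Rule.word (R : Rule) : List ℕ := R.u ++ R.x :: R.v.reverse

/-- The rule is a rotation of one of the words `rels`, or one of the words `loops`. -/
def Rule.Follows (ng : ℕ) (rels loops : List (List ℕ)) (R : Rule) : Prop :=
  (∀ x ∈ R.u, x < ng) ∧ (∀ x ∈ R.v, x < ng) ∧ (R.atBase = true → R.word ∈ loops) ∧
    (R.atBase = false → ∃ l ∈ rels, l.IsRotated R.word)

instance (ng : ℕ) (rels loops : List (List ℕ)) (R : Rule) : Decidable (R.Follows ng rels loops) :=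
  inferInstanceAs (Decidable (_ ∧ _))

lemma wordVal_reverse {g : ℕ → Γ} (hg : ∀ x, g x * g x = 1) (l : List ℕ) :
    wordVal g l.reverse = (wordVal g l)⁻¹ := by
  induction l with
  | nil => simp
  | cons x l ih =>
    rw [List.reverse_cons, wordVal_append, ih, wordVal_cons, wordVal_cons, wordVal_nil, mul_one,
      mul_inv_rev, inv_eq_of_mul_eq_one_left (hg x)]

lemma wordVal_eq_one_of_isRotated {g : ℕ → Γ} {l l' : List ℕ} (h : l.IsRotated l')
    (hl : wordVal g l = 1) : wordVal g l' = 1 := by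
  obtain ⟨n, rfl⟩ := h
  rw [← List.rotate_mod]
  rcases l.eq_nil_or_concat with rfl | ⟨_, _, h⟩
  · simp
  · have hlen : 0 < l.length := by simp [h]
    rw [List.rotate_eq_drop_append_take (Nat.mod_lt _ hlen).le, wordVal_append,
      mul_eq_one_iff_eq_inv']
    rw [← List.take_append_drop (n % l.length) l, wordVal_append] at hl
    simpa using eq_inv_of_mul_eq_one_left hl

lemma isLookup_lookRules {g : ℕ → Γ} (hg : ∀ x, g x * g x = 1) {K : Subgroup Γ} {ng : ℕ}
    {rels loops : List (List ℕ)} (hrels : ∀ l ∈ rels, wordVal g l = 1)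
    (hloops : ∀ l ∈ loops, wordVal g l ∈ K) {rs : List (List Rule)}
    (h : ∀ l ∈ rs, ∀ R ∈ l, R.Follows ng rels loops) : IsLookup g K ng (lookRules rs) := by
  intro n f hf
  obtain ⟨l, hl, hf⟩ := nthK_spec hf
  obtain ⟨R, hR, hf⟩ := nthK_spec hf
  obtain ⟨hu, hv, h1, h2⟩ := h l hl R hR
  have hword : wordVal g R.word = wordVal g R.u * g R.x * (wordVal g R.v)⁻¹ := by
    rw [Rule.word, wordVal_append, wordVal_cons, wordVal_reverse hg, mul_assoc]
  refine ⟨R, ⟨hu, hv, ?_⟩, hf⟩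
  rw [← hword]
  split_ifs with hb
  · exact hloops _ (h1 hb)
  · obtain ⟨l, hl, hrot⟩ := h2 (by simpa using hb)
    exact wordVal_eq_one_of_isRotated hrot (hrels l hl)

/-- The rule number `n` of the four rules that follow from a relation `i j i = k` between
involutions. -/
noncomputable def conjRule (i j k n : ℕ) (f : Rule → Bool) : Bool :=
  Nat.rec (f ⟨[], i, [k, i, j], false⟩) (fun n _ =>
    Nat.rec (f ⟨[], j, [i, k, i], false⟩) (fun n _ =>
      Nat.rec (f ⟨[], i, [j, i, k], false⟩) (fun _ _ => f ⟨[], k, [i, j, i], false⟩) n) n) n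

/-- Find a rule by its number: the first 64 rules come from a list of generators in the subgroup,
the others from a list of lists of 16 triples `(i, j, k)` with `i j i = k`. -/
noncomputable def lookConj (loops : List ℕ) (rs : List (List (ℕ × ℕ × ℕ))) (n : ℕ)
    (f : Rule → Bool) : Bool :=
  Bool.rec (force (Nat.sub n 64) fun n => nthK rs (Nat.div n 64) fun l =>
      nthK l (Nat.div (Nat.mod n 64) 4) fun t =>
        Prod.rec (fun i t => Prod.rec (fun j k => conjRule i j k (Nat.mod n 4) f) t) t)
    (nthK loops n fun x => f ⟨[], x, [], true⟩) (Nat.ble (Nat.add n 1) 64)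

lemma isLookup_lookConj {g : ℕ → Γ} (hg : ∀ x, g x * g x = 1) {K : Subgroup Γ} {ng : ℕ}
    {loops : List ℕ} (hloops : ∀ x ∈ loops, g x ∈ K) {rs : List (List (ℕ × ℕ × ℕ))}
    (hng : ∀ l ∈ rs, ∀ t ∈ l, t.1 < ng ∧ t.2.1 < ng ∧ t.2.2 < ng)
    (hrs : ∀ l ∈ rs, ∀ t ∈ l, g t.1 * g t.2.1 * g t.1 = g t.2.2) :
    IsLookup g K ng (lookConj loops rs) := by
  have hinv : ∀ x, (g x)⁻¹ = g x := fun x => inv_eq_of_mul_eq_one_left (hg x)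
  intro n f hf
  rw [lookConj] at hf
  cases hn : Nat.ble (Nat.add n 1) 64
  · rw [hn] at hf
    simp only [force_eq] at hf
    obtain ⟨l, hl, hf⟩ := nthK_spec hf
    obtain ⟨⟨i, j, k⟩, ht, hf⟩ := nthK_spec hf
    obtain ⟨hi, hj, hk⟩ : i < ng ∧ j < ng ∧ k < ng := hng l hl _ ht
    have hr : g i * g j * g i = g k := hrs l hl _ ht
    have hg' : ∀ x y, g x * (g x * y) = y := fun x y => by rw [← mul_assoc, hg, one_mul]
    have hj' : g j = g i * g k * g i := by simp only [← hr, mul_assoc, hg, hg', mul_one]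
    change conjRule i j k (Nat.mod (Nat.sub n 64) 4) f = true at hf
    generalize Nat.mod (Nat.sub n 64) 4 = q at hf
    obtain _ | _ | _ | q := q
    · refine ⟨_, ⟨by simp, by simp [hi, hj, hk], ?_⟩, hf⟩
      rw [if_neg (by simp)]
      simp only [wordVal_cons, wordVal_nil, one_mul, mul_one, hinv, ← hr, mul_assoc, hg, hg']
    · refine ⟨_, ⟨by simp, by simp [hi, hk], ?_⟩, hf⟩
      rw [if_neg (by simp)]
      simp only [wordVal_cons, wordVal_nil, one_mul, mul_one, mul_inv_rev, hinv, hj',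
        mul_assoc, hg, hg']
    · refine ⟨_, ⟨by simp, by simp [hi, hj, hk], ?_⟩, hf⟩
      rw [if_neg (by simp)]
      simp only [wordVal_cons, wordVal_nil, one_mul, mul_one, hinv, ← hr, mul_assoc, hg, hg']
    · refine ⟨_, ⟨by simp, by simp [hi, hj], ?_⟩, hf⟩
      rw [if_neg (by simp)]
      simp only [wordVal_cons, wordVal_nil, one_mul, mul_one, mul_inv_rev, hinv, ← hr,
        mul_assoc, hg, hg']
  · rw [hn] at hf
    obtain ⟨x, hx, hf⟩ := nthK_spec hf
    exact ⟨_, ⟨by simp, by simp, by simpa using hloops x hx⟩, hf⟩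

end Rules
/-- The final test of a coset enumeration: the number of nodes is `n`, all edges for the
generators `ys` are defined, and the words `ls` lead from the base node to itself. -/
noncomputable def checkK (ng w : ℕ) (ys : List ℕ) (n : ℕ) (ls : List (List ℕ)) (m T : ℕ) : Bool :=
  guardB (Nat.beq m n) <| guardB (completeK ng w T ys n) <| closedK ng w T ls

lemma Script.check_spec {Γ : Type*} [Group Γ] {g : ℕ → Γ} (hg : ∀ x, g x * g x = 1)
    {K : Subgroup Γ} (S : Script) {look : ℕ → (Rule → Bool) → Bool}
    (hlook : IsLookup g K S.ng look) {ys : List ℕ} {n : ℕ} {ls : List (List ℕ)}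
    (h : S.run look (checkK S.ng S.w ys n ls) = true) (hys : ∀ y ∈ ys, y < S.ng)
    (hls : ∀ l ∈ ls, ∀ x ∈ l, x < S.ng) :
    (∃ t : ℕ → Γ, ∀ a ∈ Subgroup.closure (g '' {y | y ∈ ys}), ∃ s < n, a * (t s)⁻¹ ∈ K) ∧
      ∀ l ∈ ls, wordVal g l ∈ K := by
  obtain ⟨t, m, T, hf, hT⟩ := S.run_spec hg hlook h
  simp only [checkK, guardB_iff] at hf
  obtain ⟨hm, hc, hl⟩ := hf
  obtain rfl := Nat.eq_of_beq_eq_true hm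
  exact ⟨⟨t, hT.cover hg hys hc⟩, hT.closed hls hl⟩
/-- The relators other than the squares of the generators. -/
def relWords : List (List ℕ) := [
  [0, 1, 0, 1, 0, 1, 0, 1, 0, 1], [1, 2, 1, 2, 1, 2], [2, 3, 2, 3, 2, 3, 2, 3, 2, 3], [0, 2, 0,
  2], [0, 3, 0, 3], [1, 3, 1, 3], [1, 2, 3, 1, 2, 3, 1, 2, 3, 1, 2, 3, 1, 2, 3]]

/-- The word `(abc)⁵`. -/
def zWord : List ℕ := [0, 1, 2, 0, 1, 2, 0, 1, 2, 0, 1, 2, 0, 1, 2]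

/-- Two words that commute with `(abc)⁵`. -/
def centWords : List (List ℕ) := [
  [3, 2, 1, 0, 1, 0, 2, 1, 3, 2, 1, 0, 1, 3, 2, 1, 0, 1, 0, 3, 2, 1, 0, 3, 2, 1, 0, 1, 3, 2, 1, 0,
  1, 3, 2, 3], [3, 2, 1, 0, 1, 0, 2, 3, 2, 1, 0, 1, 3, 2, 1, 0, 3, 2, 1, 0, 1, 3, 2, 1, 0, 1, 0,
  2, 1, 0, 3, 2, 1, 0, 1, 0, 2, 1, 3, 2, 1, 0, 1, 3, 2, 3]]

/-- Rules given by the relators. -/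
def relRules : List Rule := [
  ⟨[], 0, [3, 0, 3], false⟩, ⟨[], 1, [3, 1, 3], false⟩, ⟨[], 0, [2, 0, 2], false⟩, ⟨[], 2, [1, 2,
  1, 2, 1], false⟩, ⟨[], 2, [0, 2, 0], false⟩, ⟨[], 1, [0, 1, 0, 1, 0, 1, 0, 1, 0], false⟩, ⟨[],
  3, [1, 3, 1], false⟩, ⟨[], 3, [0, 3, 0], false⟩, ⟨[], 1, [2, 1, 2, 1, 2], false⟩, ⟨[], 3, [2, 3,
  2, 3, 2, 3, 2, 3, 2], false⟩, ⟨[], 1, [3, 2, 1, 3, 2, 1, 3, 2, 1, 3, 2, 1, 3, 2], false⟩, ⟨[],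
  3, [2, 1, 3, 2, 1, 3, 2, 1, 3, 2, 1, 3, 2, 1], false⟩, ⟨[], 0, [1, 0, 1, 0, 1, 0, 1, 0, 1],
  false⟩, ⟨[], 2, [3, 2, 3, 2, 3, 2, 3, 2, 3], false⟩, ⟨[], 2, [1, 3, 2, 1, 3, 2, 1, 3, 2, 1, 3,
  2, 1, 3], false⟩]

/-- Rules given by `(abc)⁵ = 1`. -/
def zRules : List Rule := [
  ⟨[], 0, [2, 1, 0, 2, 1, 0, 2, 1, 0, 2, 1, 0, 2, 1], false⟩, ⟨[], 1, [0, 2, 1, 0, 2, 1, 0, 2, 1,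
  0, 2, 1, 0, 2], false⟩, ⟨[], 2, [1, 0, 2, 1, 0, 2, 1, 0, 2, 1, 0, 2, 1, 0], false⟩]

/-- The generators `a`, `b`, `c` lie in the subgroup. -/
def vRules : List Rule := [
  ⟨[], 0, [], true⟩, ⟨[], 1, [], true⟩, ⟨[], 2, [], true⟩]

/-- The generators `a`, `b`, `c` and the words `centWords` lie in the subgroup. -/
def cRules : List Rule := [
  ⟨[], 0, [], true⟩, ⟨[], 1, [], true⟩, ⟨[], 2, [], true⟩, ⟨[3, 2, 1, 0, 1, 0, 2, 1, 3, 2, 1, 0,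
  1, 3, 2, 1, 0, 1, 0, 3, 2, 1, 0, 3, 2, 1, 0, 1, 3, 2, 1, 0, 1], 3, [3, 2], true⟩, ⟨[3, 2, 1, 0,
  1, 0, 2, 3, 2, 1, 0, 1, 3, 2, 1, 0, 3, 2, 1, 0, 1, 3, 2, 1, 0, 1, 0, 2, 1, 0, 3, 2, 1, 0, 1, 0],
  2, [3, 2, 3, 1, 0, 1, 2, 3, 1], true⟩]

/-- Enumeration of the elements of `⟨a, b, c⟩`. -/
def scriptV : Script where
  ng := 4
  w := 7
  defBase := 512
  defSplit := 4
  defs := [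
    48828184219299360037411828420507200839200731477300847394422550167403986478026802229412355,
    108132263726831036209423708817856342260558621341170971017666551689202693779386908182105701,
    178389159800333001130946757612378601220673904185969827727026502344134428993417385637166813,
    1400533074340401069549928706461982079302012662858837357]
  dedBase := 4096
  dedSplit := 32
  deds := [
    1004290295879881974130093798613032059352720371823056055222501362956290530401343921636520131,
    1386880264518326723668258679754156447904748545117203696383120238192483911481099097894197350,
    4727891959388893191274583582793900137732]

/-- Enumeration of the elements of `⟨a, b, c⟩` in the quotient by `(abc)⁵`. -/
def scriptW : Script where
  ng := 4
  w := 6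
  defBase := 256
  defSplit := 4
  defs := [
    14568803308261324168190663031528866874065174956827643734691517608321571302464660983494344963,
    330110144627801557166234329486715872816325598279542]
  dedBase := 4096
  dedSplit := 64
  deds := [
    1307285677740619843590972368245938584905314880936030198130869197226623903109101049721401731,
    3472296027817630521093]

/-- Enumeration of the cosets of `⟨a, b, c⟩` in the quotient by `(abc)⁵`. -/
def scriptQ : Script where
  ng := 4
  w := 6
  defBase := 256
  defSplit := 4
  defs := [
    15592799706505234139272257256596638611115747381036963786465591948965857014621893628653209348,
    19583517093862599083125554094172509762715260]
  dedBase := 8192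
  dedSplit := 128
  deds := [
    242847350612019223894230561047884441785903858798752593050026047271898456830720468719255617,
    398299685964315468643014078011118971001311116923908675727840259622488644333489920083560583,
    64222147210168115879974922706015972539331320434347798394956599807575285387923301700739]

/-- Cosets of the centralizer of `(abc)⁵`. -/
def scriptC : Script where
  ng := 4
  w := 11
  defBase := 8192
  defSplit := 4
  defs := [
    7585150804573099517483343326823306273508222922945276778636134721412668736870729354633220,
    17532753948731868971580848724858491166652752773877350054009445719978400452194362085400642,
    26858642337124885297485650207352774537457830069009473400935026556413862248634022685180047,
    35562891862661016633145914427283622874334676812756302047371283361371381825193666747883747,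
    43023651153436622233211230550536025390627987347859442696418962122963447471058903755915549,
    50360109978194955393713350876211336240721527338101771540204900565326645569635947406664028,
    58442523307070517352256100803786624450476952824193484068472947423981704116485538018722199,
    66773825936602827212994512342637405789063774754635750025429558739290075246868529812349401,
    74980615615147721505352961643947759551868391744983221314649401936260430217940947198820893,
    87663800142338745571456614442456682088264264938849767335483587586151754538065913793249884,
    96616772005601406919404714153504111158442753014641891942640178060202343282383230074405571,
    106813127828717849991929691697245483951434925439290684083569243758994148368243297381139214,
    115144415288559454857182027432158712878792481997712643832529314761686145545470169875981145,
    127330246223285672869284960957589420585397248008590852215196185280012503564760160190940065,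
    136158765851377434972167127552265199271048491020065799259778394398667904904062973574652927,
    145733467634536499028704615258157311683374660750297186546604262371169330236382367315477580,
    157919328934583365349167071171018696798182107955767123458236504023174931343591277245752470,
    165877578413583387144581313686835628222895917508347412040255654409228670887929053731407103,
    175700896305880204590497360134169340863962460801220917491954639005424958437357636953785659,
    186145989641968510939012515042139419832604645125832863792563099761126225851528121093825930,
    198953520168333225563300127996678890694598966536726408565937442410027588325303580404532707,
    210393259995769649167303847602796722584817523455520321495392816442171075150976999485924931,
    219221946579379125728209369953433824054626422781128435225466875878511792255614221500573348,
    229915716729299553894875876370002105611583434150712909975951605049961147611697505726416616,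
    240982418596275612269738243198171010137611209700341833776096419941628040568187770456475451,
    253417154008759298973635285718592394022168644062072365788022753469616242221751646842701720,
    262991704017206941738825820709952294334762940604018919731391140176023292153161947713390589,
    275053021993532788962358575639602161323429295209586419063515270335844586497570736767043650,
    285622749732620950734804550876152645346201797934466596162854686139263807046145148349384866,
    300419876778138741810523486936608187480380305741122868586354135943418824817038608023226620,
    310491765211212706445409301892951594339174300465792691891989486824733852167045195718617457,
    326905572224816695603739798709454410257523444497169792302023492462860082729920301071124931,
    343194805599407758498840313383441300871484494526045632377235952616742909215943189326318154,
    350904302393892539423143629015703793774516227575946339095898241007076554059252357962230469,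
    363463247187555736999335057450789041891707393703074912929600544547573996553378523259202317,
    377016990217632983931111171042195051060408686870047475557582338900233864917498942748207983,
    386591707194572257381590150090700140277992592721484548822279683233733661761727171200232411,
    400021028393706752160922404857394955296933257822061820156556436499201167229857423163780140,
    412455612018507137168046560799763816436153456517629715370660990776348216804355120517319833,
    422527697763156097264586942438997420335513103417759266732757830562098049915079576663297270,
    434589213065881946371986467743236753070479402299186170560224365526183275359155709618621775,
    446775119902787637633016570485832683178925748437930300758283168552694725505080835683257774,
    457717506128495209657639646745085281154940703690373522795934637023158190247043806590561806,
    470027743781913136222984530070097998059871756621793382013195822176409981079693601662791278,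
    478856354457787607690067721989838096161231398878577603037509744161896642437661490079698625,
    489550094255361078061112634561580847561702069529843054520510847423734945743774772168396560,
    499995172421760262647241046373009836013020200511255758976950059257844457763409393066250085,
    512056702921964430501588854391996742000918154524805123601572313238243760828813099237085114,
    525361708465012218084770185041996798261461850091386734910942346036337937299379523317674010,
    537547676006615896774274007792405558488048912879336485338815019157490891029055934219538564,
    550728290015479319075231075799681252980857059614824391361763982283132109733825282976854246,
    564282033080764146462965430676069236361378280511627046352225358436712050997133311667327321,
    573608073251278146733197258141865595229832597157663642724245549328462620734136675693203897,
    593876408579337601709617224630385099758173129986769794613284750891852768000214237846811146,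
    602207589790213283755251933404073661629801077360443968389698786205095842039183613120328367,
    614890819856116258281699509885991516534645064455722263727096236886584621542696793642267374,
    627076787403277957282235199040316148475745810164158224860452432435296556941132009705354078,
    639884333062273575579561672435156705488734145647616317812336286457892784012042878141846452,
    653189520786114736060283789696103975830811194951723279323093900194200649967393127906251818,
    666743218297860570936790874046530535438176820793887753090759112035258473988756986584609927,
    683902797673696593580366311461914668504118931732601139928507251336723418820012685783979257,
    704046908441622013043953389310139837853002250388174031738960872174635089630395525476947327,
    717103267565798840149393421632811068027433445799876195003168379756363256653550449108211236,
    533787065725164932307050092113932324086652154861194]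
  dedBase := 131072
  dedSplit := 64
  deds := [
    10229406760489799338064749628744138381824537765979981083370335978737040982615974477857,
    292880127265427428763929218525111952830738281703983543106647169506661598068471801448389,
    5866901999338564388718450903321103757135552804763290010422857755763403194159376406279,
    388557003678534660183433203544263114821549668592567134027719439497976430763500972409608,
    70930717935654950326525141784885160840796985391761248631794997966916163469948611905601,
    273941495646454895683302376765639844717799517682656359767536642038169041151273697543693,
    231698055217241962223858325527160878975693643912978312770558416869564049903259894173960,
    624092941961636378582029439294486904568320766235018133831607101945644427482801211836170,
    48143097555360595870352829527512983117256993211939911641476745480653164333789763682635,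
    624595580165972369044642300467032172860430896589067523060961149578328687625931471412995,
    336584193466997352666532968453332651502887485053253041913109190000468738870824180828423,
    19479957255492973280021068552093043001316925856884427604009836390151149144217843051909,
    140389253266290141626092940160499155276813505541274459023159540401303439736282890959361,
    216671524719866130571326080904796534536659074248658111719253738879987508167250777753671,
    86532899372682474832485896164159565151127574564861375595382811624621621562069987268676,
    196756430667493158638330450299026620357763236551941537849143110647685028321249610050756,
    30126771271245747399107495909681991647444113020528471663172289327924398419756282944579,
    276872487842783768158679382291977881710908083653822851748161478659254272165329784180295,
    629971330608878761983850751089879464649101698879579902786072686192543337093283353666826,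
    599412442164676104530522550129093380711720520267687575748219571597135714620412489936705,
    458010447841784239061070431132750300143188646762907542106853719805465420651701385507975,
    90875188062286697868655066332690311775815431472456085144496530809073218457532386810181,
    441049911780672183593194166502489283188990838644095410071408439799351147608007676800773,
    37891922414358893015992219833997744736945368251609820237354784926575599048435960158791,
    666917247861891373329132027826192702404905768761069626189551389047314641181373407200964,
    437612268864337260261938959710184136915673428480438493734488445917109440856226512775109,
    302140433794213673134656507047177363941536126951157252685679479190938097950861462556421,
    358475790020718776324097065529873735466453376234141647045047140175749884939557401020558,
    411453809631181345925324455337507714227636672188195150876176949796710309766723973301123,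
    410442827862839853030792809665030879421878100521806748644578805466503666674312246741385,
    503655711424916995610792883193434967249066458331461993133231732527823387777844063156292,
    359965513563305501136665622460893631098439295055886405748137787040534791732196757668687,
    698971529138374176947009349227802796026409356164913184094220523085309718783181053257604,
    323487203755859682022440286867608743942868559231094233491378317124205034448128358407233,
    346344599300735294552351826253549241253706349181551666472477232595673953701271578650309,
    632356232381793794042277701788598378827550027441633761690007872141976812834701007172233,
    344847750371989904114062285488386943814155268097165398385807847560713445590295196157381,
    44229673239990655352334853343687500211842637755390635130365862189359510403631139797637,
    179269161067266525310002703040481546884146162053102665227810850998805049722608272065349,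
    539619074922571673127031508325228795250245794084234911866404605487821366813838424429889,
    397317622090936321148440168382058654839942206506009196033893043889737562304476593984968,
    396831087688089192216591932424783526628049183975393065015735976090576232413867081780360,
    688711697760518995364848905660292204923531659519184381787214028123205184451076825308100,
    412911452397216488728302997906572058259276155787158106804981062864708502003383558300295,
    685334804314271745494091284431859096503610379074169863777993475877057686030098580806913,
    204507705160038896079672087820061889017253348158239746792482153398939456268856328733895,
    414860835301813243507227354159628650618817708917093411133078353106195141466554081771079,
    507578306476889556870549705357624851741934669684043855082698377280750668805589006852101,
    570758924763780615108935342390805881632834720348457199236031479341713633013917918102922,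
    571193361347074015432960825894644575094235999026597560359057180075118585857293633136071,
    188011326707924933985148648896644131030782616976928420046492063022052828087869712049672,
    189999271221278942643907978079401505298027650725951725030221840408475119371075296321670,
    381851189368272540349518802835529604940640186673630879364795779289996402554583225491908,
    21903472627867373223423796106141535954568380499340837328476092633101020662879153718543,
    184668084934435417019068827725253826232986934493386164900852742474797765786072192964035,
    672172203625444710451555321039638956842411601161752395281094373580916589660712805652042,
    306001290639434270319917185088020058285919613463238859425461682016768548320073858347528,
    414822900090435575069872656259575818586754937686375855737593824595786779413522254545740,
    186588640475360131458720310606937722000346703236767623028940116846417882543183248400392,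
    276915955653869642086537233280323612553622158180588484999495700469139069878070531358276,
    454214797637693385363335781481061302074195661936796672168680618623154544040880341540297,
    494518752558302235820997969249053810210054197448835132678500004544835167651642971956545,
    393468415589600836763336286553568705697667773905745386018126358774173835496553798596366,
    387179655937654328236613870044955255375111951050290759398687223564347051437682801957380,
    287527464694574191376859477066467251296830667808832994188505771241463014943750741645637,
    415846271894171557225921225970386274670545982432061625682426734802773701790471094178818,
    574617761647470938146013167681389902502213114897678190219692132900682957300944970471297,
    478924659746157318856271430484783474245225860176911067367364043032681861920902593718211,
    544458246119602617734941287208792077581999987893692106779860422610120984798836393555017,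
    208377928607352123939011544439551747176373029192946401528545333540793275644800639493829,
    533779573761076213093690272599245268663323616272115344179808577668991807030667403624066,
    674612096737021796670697770343608547810377805483365200027617997546051823643212854530759,
    448813058483167601518943597984886153718694686064027607406143630301674034646469170839181,
    387572990260031266146517178021492504001589755024045122062042832122468698596390623580421,
    184107535949945005071159797223739240428420320158613507903875504196295371176685619955586,
    366220735967247737876732308265511317471083358683295530394550281920215045822442861971843,
    549840196203072923970762124439483646346138266489401551482588948852539622081961652341896,
    123367990419001769754879861100144480374017528146646299877643764487218637596933833248711,
    687731859591007544562452437910037862100911433139509035401738302408951380841979028373517,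
    332298703916988110820906658445588144453737136301228765398040438801681566247498364570116,
    660064856941359344578809446529246680585402906031196958481370747487643375380635743202055,
    675598612233222641113954940423264966193209832475555803106428477182260716348241284376769,
    498852937244855190451247647051394884446676170535088603089179943244326743092695227380621,
    661012347472229961506571979353461239570044653068236560748342294526559754609058563817667,
    664920962254871594986273399093978057463003320128263891817355575103104739349513659307141,
    602247129158396798403474438531103724484034916022953462558029595327193495044608571037256,
    600880537381124203420933401191167156511540491924299178551990868594111674360160829350465,
    677609177783009480715386298703165044465661728998719066766096626976388322965256760276289,
    352178779544849818248503938397177182455480008471285291896859288600727590682793433849089,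
    2387825306806899483975112521485523559596530746202482491237549389130]

/-- Some cosets of `⟨a, b, c⟩`. -/
def scriptP : Script where
  ng := 4
  w := 13
  defBase := 32768
  defSplit := 4
  defs := [
    3978703516993249682424097580194750189040208820273549829626616885621905752892633140920324,
    7273579995835873802493431493106314523639661673209940218481133079771502155381865726607430,
    11687443242172677865803080302204712317742551344893005082569136977218923023720842205954174,
    16101333049246298053819523251435857957079914064642421589917525172395831219253328849535169,
    19769203852302259206876135373435038421969394129571587319893305054108597978288674893660424,
    23747911164265462756344447985040396525546055926932566014554803517151742899860214342877501,
    28161774410718064209378689076584318407794764607775773607534013392805762465919487392711042,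
    32699985540916705814493062356069163197319297772921326079606957076762442521920129802338766,
    36678704235994944107555574137949491486491249553073164951436785394692277384911453223256602,
    41154755652765636449817912999637407222988928256092880649010615067699286160897691811021394,
    44387443960884869097912777837645954387789765802053044912103069127564911509136532015186581,
    49547341388397957588814202197919787354301293158599367171203525201563212163475850924589773,
    53836877620660150768039973225873447799103864505193898701980223728400805253292437913305889,
    59058932864289892654739047072733007778385381645259712692568316873577237735702203607745384,
    62975470977889880538906250094741634041914573818404431950375492882568282702316427427185595,
    67389349401790582307070636852668162047564023187389633889384105485654160585848250406077436,
    73046573860509701970557746893657402293146831092458224048267842585953100875727754055779391,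
    77087442782864751412561621454711762611585440134538819240842526198333912884318280237089942,
    81998672900470690866293068903448497162013517319355469190180214006130031810947620612768987,
    86288203440972741118611869018896250255357802699966310508195808344133367027334676336870694,
    90453410760980588643242066345475528662684564836343892888782845802512877563734104510727530,
    96234964132011960606324816850047795838862866737770724329804743943915984385680929199883698,
    100089340634235852170537253457761161522883227436473240221809294083842691684446428841149966,
    104689724758346620220597217882451714289619321324388786430128665011643810933300303483110989,
    108233276134894099753899114366250020049468145657299072437268890499061074771418830974224023,
    112771468293948421361638924587648429524720681708905307051492750811087451622044145294313174,
    116439359965807353444024600768442022305702848694384025559037717928141262445145729314653980,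
    120666736484467933961862062821526252996173464442892627568065562764082842202215397255284566,
    124521099706670800799036988809340206151611546035159057434445320240020980541351796157482906,
    128872799445883439451375686031063521965711853539372315744588698854387358088673459864209365,
    134467871780361854869500689335056062104675766606645539817708344092424410149543912265517086,
    140435917570887526453261817303629737599847207170223959467926752062821874320874585727305847,
    145036294106042656633857560400998535904807127884806092834025113418561678811133598348511447,
    149388012816804914099092687954294824666217299811109722120902092177316895017783614070294818,
    153864060439879406194859677842222090414195994994016890096790717795431725850991927143663970,
    158277940761265077828780454825598765269590825887477589605936595599771659663544313913608623,
    162567488375773842111637171707672587697728114557498391422125494557274295427627373479922166,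
    166359686194004456666135173795025625828056091637927146618401131963771900138098968388864568,
    170587057020615380464039893464818753161379204361969798209085758579824726690324132770384503,
    176306460164601532524313816590548870303561542266810128136895747834296743693869167192738487,
    180533838580515489895359468975157582919425906400101839261737025817924177282112189985622802,
    184636876701696939262639246114788012464152720739945649764534362706148413716455653477845854,
    188491249409935136221947299771088578690264987999571128927814694591225408143341594485066658,
    192594291325218077583047219188364451903805291912515156781608330937474284537608321473743830,
    197132504352959578031094461783536983135947037716082076165168568032303430985516813363842077,
    203038409401722686517685225124953884334695369770062359232100682210021379958613299607080039,
    207327934250638267842284361699860022805535959419776257367053661216842273078257906176199876,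
    212736493296819430379843178711008320197024996694217676628979320623532786330189878257683718,
    216280038982243619943726649763094454735926823888053137411855158833046037081557968339668320,
    221253421224785012644226468659389336069184626737371494765174446802075852458539780081323426,
    226351136173624369917643035570531461321590068107018404609135599616206002209002861746818539,
    230578527869848839307232234378211184382429379230193810106259837685621283283064593976725052,
    235116739000279052722514332536369119053570366796900123721125969078089829650301646237077122,
    239965780947682679241694177858102044630282898587295173618458122495302243140060959665000138,
    243944486362045129670458032771155718597135765131987875424269825423942938915927923958157079,
    248296189895938238431813304901643612949037259907160957513652609482684620340436618529541970,
    252834406717433831637550027768949475855655282949457591890552962965114126785313469390262171,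
    256564450514112481417112047499518924158314479937906521629068017070698004814325021867773921,
    261786498169249752024772614446310764941393837744669947998898421307833305550165538069712930,
    266573382300999897038420770302793191722920872637924248917932663693082192938984974541754486,
    270676422319029450945499706894101859925330458388898999611623218990074314235000206917734593,
    274965964242183346381489850847561047083471930217981598592547449548744449180608071966429451,
    279379848357959999067745646825539149156745538811822680122990715154331936694050675883249989,
    284912726830475956857564982692103637292774265419207591542101210615521027744016315871531408,
    288891441730757945320087369017425251902334588195724476664925790869556988132897634544652778,
    293740495061739757270369462553636744057313167243934975142893213752379071072670532268298794,
    297594867769630588562778358472554543214477049969881954801459010702264191653735651465990778,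
    303065584631754702227340543150642095104713640037793780904747512525095673738796745103217333,
    307355130349473268616368773144452702374893693858089604285891598953014378979923367620449033,
    312266333907095035224517372817234542802492563963904873006496090633475018354987687562056530,
    318420923340756257207098008543771643455291825145107781743841099008314928436345707504571300,
    323705134503307189351255254919678380429432903207994734828672290068388197604771679848174603,
    328243334250506586535489189932654880713210388493149289221893310841839349119359640281093212,
    333341066273468448162912354159488200462986540741788910481715047086113776018701941984007325,
    337879283095890422253939913851002390981944656708481009679913627916083265830439876835382518,
    344158144525536090141397687608127511612156665407089455978488469431244676962125444404155716,
    348572058996266853637578537547146039991520377033148894384251472261321633332927687829099943,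
    355410469777013337296109361195774532096361230866360778280570791241020073431518479186859504,
    359202665697990564395831497013966481467625098008405195385947990439521224526011198744630876,
    363430040319339863182146005426244629198520629873331429934021372365456545413677409241142939,
    367346589815417995747659910800801737407844260403676192497376059377995365360418869132170968,
    372133462564168908708464916689520588486635972608852355933711804951493139089333043275765537,
    376920341004101002383251082585448312882371759734442321151830670697274371708361339634423653,
    381769396231873035197505877192247234810435593742490559385603666729970560421174873140434861,
    386991438195829142760141225765373903543741000426667056904142351888916580738833268294817794,
    391156656898604639926526227417610516161058298772260745865448642033098383154564834167298131,
    395943531544261551705656871166837019405838050562088849861811297363733844332585668620294297,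
    401041261670954283373543005013352627156570563560887120778850927477750790750488861542160612,
    404895640070489461969657813462127211887753643000617197759960784206821860546618434558695734,
    409993349327452854190691741839832032612955900087620498258709674073192875131511303632165238,
    414096393140162879974443149429249000236537690681933962809449113296046523213926640967326151,
    418199429363917255520207745314773623202466961288362820085859443619578113400680618291337738,
    421929457983089866534936518219563912928929190541458381135136473440289836658290843135187529,
    426654182401527870277186652749345800687460129517557007689279683449822352685590414354750089,
    431378899231531304085126791765649831737128308663979750028993644790303166025063797273205460,
    435357610337422307961296508534241662263040726296359947077328959113219052210434586375658270,
    440517503971297079882661388036598486620360614906144994424378164400895013558831273263864673,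
    444744869107247899737160735058453574093775224862619202290359648667731416042782797869063085,
    448474918594934020893820436641261430341911562395869904877672832161923723476067247403539443,
    453199620247373555229519580578475819340024931768579712161652141433342016572797319500536881,
    458110840879696825509036005639330529748633834816968446865611128963918065332592226190105727,
    462897713628158252946206506958734743410348539869677532024635725514361738661528790232440011,
    466876430425867294027378322128355241535265120855303947272340998193694412127437496448359707,
    471663303174560319777961751846334707963487398757150048614631403536790396122963925007211865,
    475642016177531017673970955803572844149278345223286977592764049835560681744908854202932648,
    481050552458003192795296563578149467676726093740604788488662389241566849874850483247914472,
    484780611431782538352130580679079879313590980879588050365557800945644061029047350509477436,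
    490437841581972334853884384820073525659678344904063684559784439771317087394339805659668087,
    496032893047937273701628565203337606584813228036168372507658061642527624225308505954721498,
    500135936860589389305769103730393614975242163577063078183514668172138223632471197224607536,
    505295805830807026753204921527498533427233232728170370363398414884160370207242541579575154,
    509336688033356801424948361118780678918818260345931807467499626491350315918679223279493063,
    514931758470755517523124050273422208624835206526508853607401626821261950408258143245246467,
    520340300441945710301429646882589437421517813019585001049499856206881002192528656684916833,
    524878521058411275041656688770158860999134338360138451503298973087014558010152894810726580,
    529541066792624399927085367025939408885530275006201689669041194784603690364651769203597572,
    534638785535044152989884436451172167867861602967415696429977875374301475260874801898135881,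
    539860838882173175438785561319032883641128353154786590103703929640655082236944014625317273,
    545455909319861391196019292244372161746032620024827609954894084260677424460982855442964975,
    549931937970865208911880785337686035321955706826974765161791538644284155215476360315642441,
    556210843035775508461287599927600136993240060120516477677531710260525249124642521449407120,
    560065225230106940422283728437585758276689924217144894776770169443928667876679323462968050,
    565535947783991216449286310719741503167511981052018148988656216920240945304498380216607552,
    570384985937003877817646872037688631882838681727002020153865606557962378446046720722183054,
    575793531703453479949583985765059219055471619283511978560303557542930132083009977993667547,
    579461423375080826085839140048533903950329631117865174558944397753955969027300327731995697,
    584621292345124784234355289095337007242075119361921342952057400178461531544949352589403246,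
    589470339984867537095748364920797062718364335074793793913138357649856244744988361332958395,
    594319385726314754263858109426909072887116237782822802058629655448798060474624792932656397,
    601219969500741808458466869569290457756330804760151867837709918598465836727307823959975255,
    605447346019518168697935753222880364155334842791475173931591072859603273492020276639245768,
    610607228270104221275706325461283529093355487950400543848801749046449082984556615638328847,
    615394110504543086324840338971109778979041911478748395459893999962209964552785140825269856,
    621735179076809116027997570912681051407546717880455285885655721905069951525681049770600105,
    626522065106044245042663919198361280301253930883385135961748289613030807445774530620925726,
    631495441657288652572123631774956453389054597134635121340685616627081001141018785773496160,
    639204187073533472913239621023546831840772649057898441509443908947162833055941246052050870,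
    644177575007777149600409291146452108600609922934478964750972919022792782644012631771818029,
    650456476278238564985851597265323902262099908972054981674636395799499577101319211107920008,
    656362368046980655812847076714399790318248983620473805683676472356101536581551722564298973,
    660589740771539733735943785600738466585329505406557162001371503228514051648280626385267009,
    666557803636014196802271140450087132697490532841065569064246745707655057858660252032248199,
    671406839892294549254249286854862736346930102315274236138006700978462461122891183845255653,
    675945064303035281755247499457910562261967573242428982986225527079095009538525756695226926,
    680918454134358652461555660309009161828251984429462080058706540287123711741330803315157630,
    685829669074863867867329728199135688708228531822281165980735773279864452369230472973593291,
    689746209085254051879502877379506892182423299159522856998398225391266327829614023771269913,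
    694222254811075156521194966193988740450529514783993904392487736998855426760646131350383455,
    698822633243252095277608649658093879162559559005726171194795899829072717618765543721184171,
    703174342468326388286908838792958928103172314459116899400024325976546262542673910435294187,
    708520734212760832550778259378109235524396862949744716636958049976227790970200686902062129,
    713369779954555438354852926924993937742438268696258601863820161501621852869527092890840202,
    720083850439816749526172346016802145818001140367277756819276557515603377592280217545485528,
    724373396157535328283507458839465165564857642639525775019088571745352688834499465206541634,
    728352097778375259532567205901183744400127778414840074450539632008922470561096967911583112,
    733014645409204895945300765253455301720212515964247746084042314397736332615260902609071560,
    737988027652151585694637146324503781842049817110148630428170240582911325482055942317714962,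
    742712744482097125224266493088087116645406251666542883801581748384334685778700767277067876,
    747996957541322447271121737558433416725734041459043376512588216959873661235092547171856047,
    752846018460854640681293367895173362828780695649787223945653597142366765603092359570599683,
    757011227678231671282929930148342156977046229609702866477907417514306063580099129171947346,
    761984613714874559511644987720020285677209190244850429860012025734794571105318723685920659,
    768263505499937529535743823883223044769831826443250263910543183025126553966369477114605546,
    773609887757641875239893424523854043221001579417119953903437560194174449450377523499479114,
    778023762387962161783788961935309972036999611485006707065756189983221298219110999553716379,
    783059329006951785263257800595774212988046737284874234331173974997644777539124806859141350,
    788840884275352320867867435556981837309050590953190804358891078840185026541742867330511163,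
    795492789356062417543691976085348890721772936614190484174993334597038482475637154127753620,
    800031008075506171941038343127437566304111180045674611284111459289924759465461046493327870,
    805812561446190169403687600236338601095357677748808135190771229971351698330263925106946632,
    810723787769810419553433319714166880969090757429046824020216777039947549801751171894162085,
    815075474229002044079924764393252651735194627040887080758803495410010937119944881798460151,
    819862356463730396419486387865083098367724504190014102276081097246178931021679270207238965,
    825333096091968785713750705593111131362718167910375517019958481024975571911679528183116679,
    831611999259683572651806104269513303646503211206734791955000295189356366758376719529358307,
    836461035515442846566846662767252108712888955644120460067953276233667702328646827506054223,
    840191071723802704366182012788508093319843903246206317583767331671179302726596689983583374,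
    845226623164881032670434110177953885301759349807837305647136333280396644857591329601270991,
    851132501653312584976503607343395858156773449976686862742386686295680470133528828012803361,
    857038406702654648609063329344385605663822486671141241904791403499944224022864117375284601,
    863628136893067700325401247477177813930883559229517765378020684179154405085096665563772380,
    868912365130435894658775282778331124469820633846427358616285528318546865022533395376518722,
    873947916572035301499641440487486004865095635339969145103060049241207013482370811926132386,
    878796969902380271094272257365846489471084222146859241263896388677299294397081890747725548,
    882837857796111210577133109828966143000908500877400677279019245798483234484040926291146550,
    887935568950154289749809453072224417500927806930104879744192596830918650540455331316807551,
    893281953106269972070715051448374864835266478295523759303688935444833028263078575527638992,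
    899996021695377947139714152058332656350518447582165980075688311659584429108212468504803368,
    908512951519844268278021939795915368650188374408470600665565267361341765259190820658919582,
    913983664588040609885274018483826872539334656449500274305865680596461226347211272714402079,
    918894877632045077583912759121679313119726137903291341616801056421578656700678427455011184,
    924054769368550680563263514281931105519228672794978211791436747788021111004118877821221311,
    928468642100922828884022024375280638409329616512335563723926454727000674781887382374005267,
    935120543387878820434605067144954172459840030620206949243825710860373125323657368631687775,
    942953629099550887180403926505857405383948216206116351989417940975843245383435318521969354,
    947989178643723225500889244096565354348646609827160718382392295462873938407728895611845447,
    954516754812121076944344592582083114146607123374990090648576759119863989161758801053596563,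
    960360469794123262314023091634966028140705644653602138824157652786448158071768057479707651,
    967074532691586891845947618845584814444558042761280890463705675154187351256530226139544667,
    971985753323562780557372688640052530428630882265647758040879420466800957496591147335892162,
    976959133668908674781028000510361919157235736891792238477035349580768104781574358466149656,
    982989365732556963513301243686440914392105810195578686406397883952922714577184101124783457,
    987589746062392562036443954269385884278442680472969069524343353255927077797524255980109249,
    993744312729418461655470323089794235415101272963614318551114874586106674596288265377431066,
    1000955708347590289509011755680819118704740388099906251165551541153096345066305240394743418,
    1005991271173578470578974834595828769145708539545531411120559887887893282295978472326545131,
    1010840309326706904600554026123231203612791051776953946959226720734751296811049376517439288,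
    1015813704849269352065138497237475242416634952816834955095740490298060821896452322028273544,
    1020289737294895738545935146875730671736338028919769831369433607646862888885052334681210838,
    1024517121402685629166278031462359466026628040141867926425812760705011620077058421089648666,
    1030236518854969527277037127530923081644179399532978378926328524023799773835554201363890275,
    1034463897270594006191782644184899590119499791994240114723493699122762302853462099906085055,
    1041177963961869606856789781829737146306245345624825754183237084370031549139397140189364487,
    1045778340496908973218240488549254048668723013967765261473514908024325349877473304729239919,
    1049943551611018318038472209654804462881637357892649829219653539360547461736375199337562554,
    1054916949031297310712944542997563792013616791263394886154424335676504470506799618087961100,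
    1059392985271025182119903456586297223713736613546445552209064401453125416966029161091580494,
    1064179861814051287577392445171768813376764664354965030317907009895824251350682635137106579,
    1068718078636010073876584401475827615464102674271620544457800989937448116109655511709827811,
    1074499639595591802562619377435094576135665611605447766533745105329352717114766247954006828,
    1078789179621839690346210307797796357576931201143297707088618422760940896222084930899985288,
    1083327394546429314770237167028999562670384713192897025966466286534454897372287634334368715,
    1089108951711735865095119566898496864312962476996933995038963597585691718083835182703297556,
    1094331006955712988550503165852024886059000539324748789748940029281981526020030179512829047,
    1100609891151646607834452310151580661466313967997147019141995031663123947968254252787057880,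
    1106018461581290183150056501556645595175952997790007598434185384488091323824999685944722725,
    1110432345696545746698130587605652229220326391159622086747037672134284742124862172393719171,
    1116711237481608718488752947794770344002114101170469252860391421882579814241015368570783186,
    1121311615913669851021152796836979881427306878871220242763756112202412762990942004847363630,
    1126409330862451301649137924674499410077101486476107057280975748594427961504397309559785083,
    1134242424162963226543686297644070003455315953458676105008458240739542616436796890899039942,
    1139402295030376357168072470143881878378029469151005647741257996557981457593432634642843464,
    1143816173454682331248890973072970255760044710536812955084454793279523148397459992713480086,
    1148727390292035647661632822062099167531955644448019845428492354688909226174240385571997666,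
    1153949449330751144339118340621408932079741918980761300709083056085909385894157140076185650,
    1159668842988470367962983482804961228423607098802095862575404393699063003552664557432686723,
    1165699065566662274651434639153000296469411239250633454563389521191944252973359897364252896,
    1169988609387069545173138866647574562031043146570375767087424488891238963889391199284578622,
    1175583651366535974940017276031615758437692410851774005972048596751601195542651776096749958,
    1180992229384903595112375750582285981447732331836144723788817925007001662785284421157702119,
    1185468275110319409773050908646362844032521465215320982579518255146184851278455679238457914,
    1191374166879293083012105324727904614848063019940219387973399132234458457650310014488988287,
    1195725885590344817166254330881370722524587882345816945274655539260096044320229408969247455,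
    1200947929451091112022390694027246209479806185715735667157029272410662415322031266238679847,
    1206729479027615705543036400583098178553437919003361853509310806203230263905466500247243640,
    1211889374557585926357524541508134296994856784562932899710528689157873856713302406199102422,
    1216924922206010204421660343801025080992617675924971705406378336652513250234099916615371818,
    1221214471718061836382062701371872454148802595629328628604626733253739331351619147434773626,
    1228052869218729397501712873663276987328917281602204555206728904312538756347265642213231811,
    1233150593653025110316838672909222741998379140832441959620427567177114205788581563742014763,
    1237750972085317846463516157462746363288328495264360189502600214318428205299356518899010943,
    1243843363861988780341985228294186654040669720015067482847450661094021419660382295933898187,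
    1248630257479716361200480192603222816322728642262690364047511073386141156175837473430523435,
    1253852307031933327594773383395836700558923325380662032014342155798073400402906574342803066,
    1259136520092085011091817456384521214499321430029132582167078903456197657586220015878196942,
    1266161413805653567118502869061643202492735598495641440270020852448554878862384390244650795,
    1271072645821381366500130380221632232706057086206084487222686416705745230825159782440718228,
    1277848877917787172144567126985268666305483198613032503411446988344744167449796748587978720,
    1287049619603882388815709934305496575155321162852167088041681935496063165609921082431262803,
    22256125464802]
  dedBase := 524288
  dedSplit := 64
  deds := [
    465992753618012885144107163250726594629397916581858006856557660641300804610577644202754081,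
    1360989790376516790334335560204060523983950247384824325312638521291080122805957068520432517,
    318848424623992927927881282340519385066812160629503769880806164908167488198459528444925320,
    473639311148137824475529570725296513017385819432932522631008095596171658485648670590524546,
    3397967485929321717400277623342798640316318009772869207796170295679186113874307180057034693,
    4102362691152086418904399469962240979548763557853970506189816866086673067907080059449026184,
    855535808934726868493592953183723527075964090430418863960709810034975201320871160313838277,
    310583430892062979149463408091354714426151355599517236436703640678493017739804990511776396,
    3008246175633902772769313811883223167770385695083804723427806921236456083222503215372178311,
    744432161921059820629549296426262229476861116664747652837022097494085459221154388224556355,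
    9958902090005114200104217371485819746490078232915209432113012914352921041732598027182946631,
    15342016668039274958753289607586934928411833484354161256049130553902091067883301141693904137,
    103754250157879869601386582679478909040686930421520468262803329010420219671223939539404746,
    2057118423204813807850496975303294710064194186218859174940378336733255823100839550574444033,
    5168435012898394393657021894464387458238580796279790162993271079941120531185171812420591362,
    5148434827009799685335751504104740893004349523407269087822639765643082838500459138595177742,
    171172525265961027540743422176241219517379540664715917790312239032130156465493839893254531,
    3437815616862846721023242128364809941380614315674363513269990575570340075303419549224896078,
    11323556245732826583773571077811472661393519340707221971776555568659657312854842874654671049,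
    8498446742689343357350043616583531639398484290852684410790439069332004839824091609570478343,
    776137741214175359740913757671521872059220833183659201378009690422021617468654837691979206,
    16360446857365844848577834498705839473157312363980877848480919792299642466880733498435099777,
    3855500387123366209087318004171377022165099867540812318299035901743564889983534404461942855,
    3489723805788512035137008275203270096327097094446485338663750165383737156022993626063252812,
    3461888691334219100069312345405528759319820827934111822322016728093425194648808607443346701,
    5367433416509689908405839369555084487853560723689056161284414653865843586108557468495305154,
    6250494649936961232395602582393524578755805408836690923239743985321118279262058824780566786,
    9636448944835064806220200128670535870421418873764954268408944426685528396702711721885364997,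
    2272647785510754957767044365232885037783578441057936461744433055182564178806913779617025221,
    16666639438250439432130110196886193679209532420771004234553384421956990295700387194729964105,
    1834447172135107425791590213992516457507972235748713529726217211707306850238005682631865231,
    5379925930927742994978580142798582938357583166989791731275706175687598387031860497959403983,
    2709860460108597680384155433913067126101346131092566254093971826852302177514652581065478657,
    5920520105744375552480636334347883195306111297741536280755715444256148166986416902211475207,
    3720053034618405054884331817070245853183521042781725383369701809736395959930679451050472834,
    9652373206167655815712397304223637257867445270929853567088766015142064801498177183608251459,
    10380597020757589052820893976887265935645101786992822434135055956631702519722421550321298247,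
    6795766263487929742786039160367590448617721174227203333439122680332158378306785084661564613,
    4850209776500035396465855588182281030987933328578361721919248634176605107684250225010125634,
    290510266252029381327524982031266309846598869518113699071888680357193720592330427977467333,
    7082386107711873233032600966213874673054795303573004905746599406636333807992427225674712449,
    6501469918874833665854240916961836180911819219709275241105172434065201082751007935476347973,
    4174116547706647067080188101277701146757114728745745453934642306738998770092965037145235715,
    4185555558747669878909457379232261992782732396943217910562072999278577490904971467500410371,
    17306979294677029654936241675039619964124569532169683648564149754114526768549611232428770440,
    2160530034551441605491805208383785943462183732620319745420433072656288547302263905228439497,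
    421795473972330983908318730581147183318846484890046198854717779078232697362987537889520197,
    4957629530785849691236472994890569338513733140558129735922411096141656053075074408049628741,
    5470689303668596073632149189749148378514901844350178529618074682346246372309063640600884677,
    4635869570046380497163603825360439986310903199816581455605291792356629422445443281380230213,
    3346255097385164042076877368830132533045973691715066688810384307311007299094908828068181637,
    17000564072861578678847371001630555812838029171815987005786697660643597700341634414690226885,
    3751902294347911643202399722483132458043902208526708615939646976769318306859847035880922889,
    16733999137743056588111018528858489222136475546887937389734783334960195479517245121825086409,
    5976645176419691496737652452472941960737037433746169710759622337832806526653962586098917384,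
    1265317438266900234113561974089279699542343419992891289898263042415280479220276373924444099,
    5518806480511663316028718071516230460690594279801893071933031403797463803628351619210432201,
    13996801023585637428604510143171169201527399620705442916339506703774730785405078446137760905,
    8514616509660164919153843642453083647403772337644734234404148535036400818752384582602545410,
    7090596470384904050673079617165324765983409222859443345604891022461853770390466629251686029,
    5184182575673282351497647985651692233567101641866973308213372919251976966121432980885428677,
    5239994102433265535782756090169476769593535914756263224470686820768105386257349463881954440,
    11049051417367586301272089734011148060226967502804514738811955942765180458242604597479286152,
    13694761960105711962184780550234885472413441523118368343890344311513125380039635857366496899,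
    449830143515813042912104571891174630413406262132063474724510694032354325625862380820119561,
    6564797031791200375442127852667655522113075233669599796865909397557950792256076674521271879,
    12083287790094600126415242936908893399023498296673577532326593436900627189781979858096717061,
    4440234656001761894345347289490586201148448286989862981180611031831804572988768019056621442,
    4209668322531142701750278642984798474556458899880214115106669132244676371228319219571597188,
    15043238290336510725507519587824552495135757478200820277004693664544141841039893669016045771,
    9704224717167849699443587154944530932228110272414830026835263305040818456727138662065304840,
    17362645751159780632923994111046109890970752269654084645564831955694519870325900144981205838,
    815926999302362733803966275537493389013462733211365483094226441232866262848979337587480129,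
    3202961799178911292931924282670747214894432250208493606923730832485075760827509937042109256,
    7173714894773668007548683143722491671922840842278886908071320634180617724432616079381791938,
    6632750481519848997937048334908440135786002723508393465233258456937808288360102621373645639,
    15051081331191117411429517072804796342216315610788728695046090008497022854220478637684654020,
    4730737187386259415819743498368101716444989815962843618668480357752362889467935690529164487,
    6270692943377124216027879977795765314333834115754455422345970901753550152923203005596209473,
    15461006435469047497385839208073542468503873171889380703600258053530470998549995642054348617,
    11709731146599574405315633692769780596045419063321260597848472912794457621832444080256996620,
    18643751190671913603832100761239860725375557724917416232258021365406321350991455871124069826,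
    959350244108528845184952086160035089155454136252909744781602534386837177407427357655497794,
    3632777541077884488268136353803976444890957534016771506220041532302033031293150597343211076,
    13412335944351934229195077355825493544319550732409116363722574077516509356137243395173704776,
    14001109143029724249921284837411075739558305652623483004281246786681385141300178567255645705,
    6926872593694320188136649386789990597267984311851777994941648778806608786546953894145142729,
    8586112369708558849577991345550786836765309284195004166365270005274976427994579273841293700,
    14025274517370498341387380771976659292651021343493713567216715050873955922651546122261765000,
    12397370119659303824464616556912648003364912459488054772971845643739966220337103652865672067,
    4492080693116057354712906184909056964480234216072283386457192074968397806680533920875047944,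
    8610608772251597821552282877658524855400078396745241863825973928065383298788485630683553665,
    10094175869506946325131318411148381586183869963080206971343112952120592825774353962629734467,
    7957432153929830018761422131039718037073001241989867541506037015007458904309189731390487177,
    16193674523068534224575765359020386653323040157720671180419268390593005715030031054667350215,
    7535891307424496878188155957530277075563174317543269701028242892935482798367703936378075527,
    14605589812669129803980037058035061909985109511771008444057122973752960412419073651514109958,
    16169194769388657160075531320263142923848703920555586749039958193988432611329995761547737288,
    18481312714931727467523418840392572930655173192244103535804444636653488199144118165416704077,
    1344983420455148965276129069570440156460031869921693542248402421384079276359782882754733063,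
    5056915665002010664844593962572164171897925604742964459123163020002693678517260089215462278,
    9365671293196620593228816832560006278978439110729173289526304028338393382772988849793089027,
    8705469560700718436663785607821712103540543675089463374215700869960345453363794161248212549,
    8013711051665075155445051477814243161691249268500119570924796343740370214115284138829948487,
    12417444005171152738133220100867380016500669778228817906612685365296541523405937747839154754,
    8379741507870047439050036446529377218374897616690418109238967062860479246295473947090357320,
    6429729379773537574567307491612786667368614956263179118784770989619505740285018939655327105,
    16463860002001296426951461817952762521250548860705621542069441490903310449852418357368493956,
    18540433198870223862636610463653702665283665574029456243655306141685524959915874733515344588,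
    1536080253535554626566642512247402368280245663080975026044529345753676061340444695248199623,
    1524117009729750035132919856938990558254278294771360140354442876876512163534059341909003723,
    10118138727667734784092836201048236399235205512252222565302535324776844421370363522815909569,
    9516919927597937309768217318175021281272695762214157085307544907351535849765132637095755078,
    9437607609684304954662492727680344583673098202827263465222481373526814283302471511704752579,
    12803181250833715794939341248535987457369792534573275575703176196941662550701334857476978305,
    9079538043663668135961506322546162295428426760012194942852517185372376614258163127174287689,
    13110087163473785416878990033859274442708501540809671709373165162675941016352377862191987394,
    9051381175271831091372999121609846965884240892881641259946991447970470057461323038577604808,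
    19284471907733113793574593394194636439784022834532641134696854029522943755511694008677814280,
    5637729141669605652093682466492176370375618817858485604295830417683585618107154375071022595,
    6155381437194956790450322672966323575715315872986467833885776588629304306672309195678245442,
    10862131012508361064980088821016865964918921122730135954954791756172894446588897426592525633,
    8045462046984509134175489810765062634076402161277406262101251395959247508938369432804829772,
    15568791147180413949240801228496305002943412912721822933190554813959470798848258395200944643,
    15922517626145856701051327424299624885044453577388641110198804419854929634909511237563483205,
    13790356788214221335018846951109094608467652718973508629423071040538070975106094984414357761,
    15906898317091981004864048075229413164229297933273035452550601868952963710634471100791874248,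
    9743893969362899971198941800920082301671738237774456607374898004429133733635406108320982017,
    9783920886402773357424909727443931374989474675612573153586973481370985533887044288354280073,
    14916538442532658529096222519407648918822191775968785030745814165899563287747322409656115596,
    5132645247041211552335687105017708840535438986169669224227243554012449664503781195364990594,
    15966272448291896466623942908828067516062131690429300704033174940661874974448527089913212232,
    10925600272645155785648547699143443495270697301483021635321411366615036843806068688763933639,
    17144256628462330543046554592907580266320098838761236285069136038944303846324913867119651266,
    8411072333127246911196379578612379405273554476349294808434743669076781625638591708688250497,
    10611157267943091891392260390541182746107225723665124554555089229321500059245300825928110157,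
    17422317178167941930921373212694205992707105918377799012004950859446798606716864535535025223,
    19662643566431161785808553516198253980459761436876758035577163323910327038693955383927291585,
    19821888499655222536694385571582310438720465120841822813176722129357830570445408519318198920,
    12154708638365536577841984404472924659673635486292226863222792491928071851136869707540651077,
    16296629713098566357396521094040722710703544907434944474690987284673073126634986879511615047,
    11589838288672421548720081084533090534664718866250178152839701079490384449526268460752633097,
    14697670262045205330552115404169438959666670687470794169569833436964682099650644974338495493,
    11227839546743477429504794213880055016329291593675675122857422974201196898737097858185665038,
    14923952797037743997235704104415948804788256199148270651869801274263983201923314720399069900,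
    19367917763947919120530494192112914846751131940269058239082288958774070817092220284829352389,
    19865552387630122788542527568875696075348737132355197513128872776080107370176158729982683460,
    2638615605640996652816461978918583887779880218602762260036050508785280766207432751686934607,
    8096748552693522633318338555845651554882877748138318261438532740600328753974295912891867142,
    12198555388003300553691970046143633616093779438129505712894366935845773161364613995304904584,
    12250346190580100847905570606623892441065898210400230848809479682964685331897487780283582594,
    15174669591985643533004734647572019645603799571154973096531951307286099689290976788024638468,
    11967733237867668658974330943349337267301915925113736036054200049641880489593819853008124296,
    11868461946868936965957411720660890727645406304459452905275284022237960232906096664981990473,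
    18031281035564638777538160011938140800641696148729754010607119459514538090538634891892106057,
    20032649534796660582104356507771019400008528091702088383748340278655589037059753247708472591,
    19587175182992502945253829300338055411240671188837543229631951522919447927060022565895203592,
    8860708389830768001239721684676123306873640311939011332062816014529910595084331741732466627,
    16901554882827912193128885294812861374886587378999209871618247820964422591826610006188043085,
    12942556231775432383704312328320365579734368769466168886139794283400939479527616541994209539,
    15815406042055036434355682532448203302479818923110036530504420706767978436950617334857586183,
    12612327569423924111265224776677946067596675373994227066306169849308594342706502850139853377,
    15807318863472085776074657063430080666784747854058456595619526752120799495130646061254876171,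
    20151762464853811713799493884748502497903365849814967938484524878446957704490383819134984135,
    8454595817834262192191293532399251743135637794401875331568068788454139981567340887919618248,
    17227616785396357851702682682704604157809478152979358950134296615372484234562127714620943689,
    15994500686610026888920835629388713476157284286995255240102298265117566960357903247116292995,
    18596254696834329020217140447706676743135708792400653938918033216943156260563342980614450504,
    13201781309145753763383406173406924606659825437729375922166122489902009328591883721400594439,
    13165352542160085135890729029983870576534904048378316607041755845446844773862573606357909577,
    20040296850992020574671046908200279881079759842653873691198898373544139008605012311606556423,
    20326696216217380392017743641755730332814561649353452556737166286273818526909544196474727305,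
    14192318005241663585651233154923675925404337166438578901303140952080242758885419292903669763,
    17554046414330781275699545104443126919046944067718935447602809203262349233050018300206742532,
    17578109723383242648413709216581625235309452959595951472992044495772996239484284480548207362,
    14219927071938907873095922175092553606976444115191779155581014141485928231948226015217315399,
    13885788423943697855645261109498753663955063240482347827883377893840274188318303191291352770,
    13861921925822732266193427042292902495544500743357196923504235434188737041115672507110353485,
    19586785161659416427877336037124130296111922042753683266970679363927636763176514101315331267,
    20426596242110264672362335249182981284940321518260406489890909827963058314405172200948306374,
    14784950672527593519369476736453533324838366091799448215213210728660201306781198119082459909,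
    18094951196171698957998008807476489371269569304979614581278141478174882471222300797326572929,
    14490223480392485590885895917975371549997607303394757309723098572694700581574543831139643719,
    19014000348169167189362173195789396789075382460328160598455232746690848577299545547213118792,
    20346959679998958204037155003401773761242364762334556954507390112942154535322062993417275841,
    16937061194539601537269768039319176793631072175381377907384929712752742144127431363630270599,
    14999546027982142240832615765772463893709793430775261299168421871412912825816159088981864907,
    14983881727044173583152899750886031252714762350937980613771042385189871259304669730476633544,
    15314476605232785584923773321949711298896950881300857769468825616954450428319666342908374411,
    18576986281364793539861012263067420645085919644280466720297259620807699073685905526808150405,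
    20454254071419592076893748427632053939701597926965666946121652163680699842827921297886102339,
    20533946896225129897005918382844714809348752151634687307527373049840531818119740067465203210,
    20501742803508046748899161227385251007854581311438182805826645665763699886015054098610772616,
    15687971743055809785447800151912334606807755007509315324543946791683173239639017412555924493,
    17760938587734028353942998788816660458983669665011335446309849398962344928952753232817193988,
    15426075436339362531648457999]

/-- The conjugating words `w` of the involutions `w⁻¹ (abc)⁵ w` in use. -/
def conjWords : List (List ℕ) := [
  [3, 2, 1, 0, 1, 0, 2, 1, 3, 2, 1, 3, 2], [3, 2, 1, 0, 1, 0, 2, 1, 0, 1, 3, 2, 1, 0, 1, 0], [3,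
  2, 1, 0, 1, 0, 2, 1, 3, 2, 1, 0, 1, 3, 2, 1, 0, 1, 2], [3, 2, 1, 0, 1, 0, 3, 2, 1, 3, 2, 1, 0,
  1, 0, 2, 1, 0, 1, 3, 2, 3], [3, 2, 1, 0, 1, 3, 2, 3], [3, 2, 1, 0, 1, 0, 2, 1, 3, 2, 1, 0, 1, 3,
  2, 1, 3], [3, 2, 1, 0, 1, 0, 2, 1, 0, 1, 3, 2, 1, 0, 3], [3, 2, 1, 0, 1, 0, 2, 1, 3, 2, 1, 0, 1,
  3, 2, 3], [3, 2, 1, 0, 3, 2, 1, 0, 1, 0, 2, 1], [3, 2, 1, 0, 3, 2, 1, 0, 1, 0, 2, 1, 0, 1, 3, 2,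
  1, 0], [3, 2, 1, 0, 1, 0, 2, 3, 2, 1, 0, 3, 2, 1, 0, 1, 0, 2, 1, 3], [3, 2, 1, 0, 3, 2, 1, 0],
  [3, 2, 1, 0, 1, 3, 2, 1, 0, 1, 2, 3, 2, 1, 0, 1, 3, 2, 3], [3, 2, 1, 0, 3, 2, 1, 0, 1, 0, 2, 3,
  2, 1, 0, 1, 2], [], [3, 2, 1, 0, 1, 0, 3, 2, 3, 2, 1, 0, 1, 0, 2, 1, 3, 2, 1, 3], [3, 2, 1, 0,
  1, 2], [3, 2, 1, 0, 3, 2, 1, 0, 1, 0, 2, 1, 0, 1, 2, 3], [3, 2, 1, 0, 3], [3, 2, 3, 2, 1, 0, 1,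
  0, 2, 1, 0, 1, 2, 3], [3, 2, 3, 2, 1, 0], [3, 2, 1, 0, 1, 0, 2, 1, 3, 2, 1, 0, 1, 0, 2, 1], [3,
  2, 1, 0, 1, 0, 3, 2, 1, 0, 1, 0, 2, 1, 3, 2, 1, 0, 3], [3, 2, 1, 0, 1, 3, 2, 1, 0, 1, 0, 2, 3,
  2, 1, 0, 3, 2, 1, 0, 1], [3, 2, 1, 0, 1, 0, 3, 2, 1, 0, 3, 2, 1, 0, 1, 0, 2, 3], [3, 2, 1, 0, 1,
  0, 3, 2, 3, 2, 1, 0, 1, 0, 2, 1, 0, 1, 2, 3], [3, 2, 1, 0, 1, 0, 2, 3, 2, 3, 2, 1, 0, 1, 0, 2,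
  1], [3, 2, 1, 0, 1, 3, 2, 1, 0, 1, 3, 2, 1, 0, 1, 3, 2, 1, 3], [3, 2, 1, 0, 3, 2, 1, 0, 1, 0, 2,
  1, 3], [3, 2, 3, 2, 1, 0, 1, 0, 2, 1, 0, 1, 3, 2, 1, 0, 1, 3, 2], [3, 2, 1, 0, 1, 3, 2, 1, 3],
  [3, 2, 3, 2, 1, 0, 1, 0], [3, 2, 1, 0, 1, 3, 2, 1, 0, 1, 0, 3, 2, 1, 0, 1, 0, 2, 3], [3, 2, 1,
  0, 3, 2, 1, 0, 1, 2, 3, 2, 1, 0, 1, 2, 3], [3, 2, 1, 0, 3, 2, 1, 0, 3], [3, 2, 1, 0, 1, 2, 3],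
  [3, 2, 1, 0, 1, 2, 3, 2, 1, 0, 1, 0, 2, 1], [3, 2, 1, 0, 1, 0, 2, 3, 2, 1, 0, 1, 3, 2, 1, 0, 1,
  0, 3, 2, 1, 0, 1, 0], [3, 2, 1, 0, 1, 3, 2, 1, 0, 1, 3, 2, 1, 0, 1, 2], [3, 2, 1, 0, 1, 0, 3, 2,
  1, 0, 1, 2], [3, 2, 1, 0, 1, 0, 3, 2, 1, 0, 1, 2, 3], [3, 2, 1, 0, 1, 0, 3, 2, 1, 0, 1, 0, 2, 1,
  3], [3, 2, 1, 0, 1, 3, 2, 1, 0, 1, 0, 2, 1, 3, 2, 3, 2, 1, 0]]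

/-- Triples `(i, j, k)` with `i j i = k` for the involutions given by `conjWords`. -/
def conjTriples : List (List (ℕ × ℕ × ℕ)) := [
  [
    (7, 30, 19), (7, 34, 22), (28, 7, 7), (28, 30, 5), (22, 11, 28), (28, 18, 22), (18, 35, 28),
    (13, 29, 29), (29, 28, 19), (19, 27, 29), (27, 26, 29), (28, 36, 13), (3, 28, 10), (30, 19,
    23), (30, 28, 5), (16, 7, 23)],
  [
    (19, 7, 23), (23, 20, 9), (23, 30, 7), (16, 11, 11), (16, 33, 22), (11, 19, 6), (19, 6, 21),
    (19, 35, 31), (9, 20, 2), (19, 38, 38), (24, 19, 3), (10, 7, 3), (1, 24, 32), (28, 24, 32),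
    (19, 32, 37), (36, 24, 37)],
  [
    (5, 4, 19), (5, 30, 28), (7, 0, 32), (1, 20, 34), (18, 1, 1), (35, 16, 1), (18, 20, 6), (35,
    17, 9), (35, 36, 2), (14, 11, 8), (14, 35, 19), (34, 14, 21), (19, 34, 33), (21, 35, 33), (28,
    14, 33), (33, 16, 13)],
  [
    (8, 28, 2), (4, 11, 31), (29, 5, 25), (29, 7, 38), (38, 29, 15), (25, 15, 15), (25, 38, 10),
    (37, 4, 7), (37, 30, 27), (27, 30, 10), (28, 27, 27), (20, 18, 6), (18, 8, 21), (6, 28, 9),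
    (5, 12, 37), (12, 5, 37)],
  [
    (38, 5, 32), (15, 4, 27), (15, 26, 10), (26, 12, 15), (32, 4, 10), (13, 16, 22), (1, 21, 2),
    (18, 33, 2), (8, 31, 1), (21, 1, 13), (8, 17, 17), (8, 35, 6), (8, 36, 9), (13, 2, 2), (20,
    36, 36), (9, 19, 1)],
  [
    (0, 5, 3), (0, 30, 26), (7, 15, 15), (15, 0, 5), (17, 19, 2), (18, 17, 17), (36, 19, 19), (11,
    35, 22), (6, 31, 34), (11, 31, 2), (18, 31, 13), (16, 18, 20), (19, 26, 26), (26, 27, 29),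
    (28, 26, 29), (10, 27, 37)],
  [
    (30, 10, 37), (3, 0, 15), (5, 15, 3), (32, 26, 25), (29, 12, 3), (24, 27, 27), (26, 24, 37),
    (37, 25, 3), (32, 27, 27), (27, 38, 23), (18, 14, 36), (19, 18, 9), (24, 0, 10), (36, 26, 26),
    (3, 25, 37), (37, 15, 23)],
  [
    (27, 36, 13), (29, 26, 27), (0, 24, 10), (32, 3, 3), (25, 3, 37), (23, 3, 3), (24, 38, 23),
    (0, 4, 38), (23, 38, 24), (38, 24, 23), (12, 25, 23), (11, 18, 28), (28, 35, 11), (35, 18,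
    11), (18, 11, 22), (6, 19, 21)],
  [
    (11, 9, 9), (12, 4, 24), (23, 0, 12), (25, 0, 23), (0, 12, 25), (21, 19, 6), (24, 25, 25),
    (12, 10, 10), (0, 29, 29), (22, 13, 33), (33, 34, 19), (34, 19, 33), (20, 11, 33), (35, 14,
    31), (1, 8, 33), (8, 22, 22)],
  [
    (4, 33, 9), (6, 36, 17), (29, 37, 37), (0, 37, 37), (37, 5, 12), (10, 0, 24), (21, 20, 28),
    (36, 34, 33), (4, 23, 23), (31, 33, 33), (36, 21, 22), (31, 14, 19), (20, 14, 17), (11, 21,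
    21), (16, 19, 19), (35, 28, 22)],
  [
    (8, 16, 34), (34, 13, 13), (22, 18, 35), (35, 34, 34), (6, 2, 22), (6, 18, 20), (21, 17, 17),
    (16, 21, 21), (14, 6, 6), (16, 6, 6), (39, 1, 1), (1, 40, 19), (20, 39, 28), (40, 28, 13),
    (13, 40, 36), (40, 19, 1)],
  [
    (28, 20, 39), (31, 16, 40), (36, 40, 28), (39, 13, 13), (39, 20, 28), (39, 31, 19), (22, 20,
    40), (18, 40, 19), (9, 39, 36), (19, 40, 1), (14, 31, 39), (39, 34, 41), (14, 41, 41), (34,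
    39, 41), (41, 34, 39), (19, 14, 39)],
  [
    (31, 6, 42), (34, 31, 42)]]

/-- Triples `(v, l, y)`: conjugating `(abc)⁵` with `v` gives the conjugate of the involution
number `y` with the product of the involutions `l`. -/
def normTriples : List (List ℕ × List ℕ × ℕ) := [
  ([], [31, 37, 18, 31, 18, 31, 18, 37], 37), ([3, 2, 1, 0, 3, 0], [18, 37, 18, 31, 37, 31, 18,
  31, 18, 37], 31), ([3, 2, 1, 0, 3, 1], [37, 18, 31, 37, 31, 18, 37], 18), ([3, 2, 1, 0, 3, 2],
  [31, 37, 31, 37, 18, 37, 18, 37, 18, 37], 18), ([3, 2, 1, 0, 3, 3], [18, 37, 31, 37, 18, 31, 18,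
  31, 37, 18], 37), ([3, 2, 1, 0, 1, 0, 2, 3, 2, 1, 0, 1, 3, 2, 1, 0, 1, 0, 3, 2, 1, 0, 1, 0, 0],
  [18, 37, 31, 37, 31, 18, 37, 31, 37, 31], 31), ([3, 2, 1, 0, 1, 0, 2, 3, 2, 1, 0, 1, 3, 2, 1, 0,
  1, 0, 3, 2, 1, 0, 1, 0, 1], [18, 31, 37, 31, 18, 37], 37), ([3, 2, 1, 0, 1, 0, 2, 3, 2, 1, 0, 1,
  3, 2, 1, 0, 1, 0, 3, 2, 1, 0, 1, 0, 2], [37, 18, 37, 18, 31, 37, 18, 37, 31, 37, 31], 18), ([3,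
  2, 1, 0, 1, 0, 2, 3, 2, 1, 0, 1, 3, 2, 1, 0, 1, 0, 3, 2, 1, 0, 1, 0, 3], [31, 37, 18, 37, 18,
  31, 18, 31, 18], 18), ([3, 2, 3, 2, 1, 0, 1, 0, 0], [31, 37, 31, 37, 18, 31, 18, 37, 18, 37],
  18), ([3, 2, 3, 2, 1, 0, 1, 0, 1], [], 31), ([3, 2, 3, 2, 1, 0, 1, 0, 2], [31, 37, 18, 37, 31,
  18, 31, 37, 18], 37), ([3, 2, 3, 2, 1, 0, 1, 0, 3], [], 31)]

/-- Cosets in a chain of subgroups generated by conjugates of `(abc)⁵`. -/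
def scriptN : Script where
  ng := 43
  w := 9
  defBase := 32768
  defSplit := 64
  defs := [
    4289562793114785492301068257714302365159310322669449339300258588284139790110642832080904,
    8454747345908249493025507824067758535753039376047613358675424164983294037500410771734622,
    13676758955547219351736545566124089758135737536509637274886146075316171927751186512117901,
    17593329320659793943229240368812608641211594697000085693029394507025285932578925534314703,
    22255869357207331645345680671438729502954860869741276865561499343462675818832130282324239,
    29156460725800678325856776701703352682154012337023369371363964093982841382248781186105677,
    36740793751221311076671970748393347155347150940367549993945346734992091600031980144361930,
    40595295470258028449631982657325835348712672820563784403767464266683848444382127514583635,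
    58002035607100760398261960987905915786725239842575584115436629474034702279715364207723172,
    65275649760329477696466479901912280881051350182393613831167256376074142511007959344055189,
    85666490583500304269721727535122831032125576816318555439481953236342125904248546194359398,
    117744562164628386920372455527447624237564441540580168293971718740234142422954335152506211,
    198997064279826226763759351780614160140911817647253021695786491416923155443777888435406752,
    6058746942918077123743]
  dedBase := 524288
  dedSplit := 1024
  deds := [
    68195578746864328300828701781364730237228597078070872942043320130114324822476000138362889,
    326617657893014209934150788272433235983967999756704893007807465630256409980735414061761616,
    903264928960740143490101956485958318072071976419111672284448085597618075925228356122973320,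
    1225406790961683057960016888294070437654743444579936741942987217523730871434196510880839878,
    1541394033655124952693997519537301857832517224489270525226517105263313589049101622626503940,
    1790180442844494604467863912958131345544485772917627626431267263410850756973675321037447472,
    1725590622138475997003071243038117898484974135522814248878642487523073667875063011224875137,
    343716426080319675517093537443927503889922311419976645271178284676113376538973687309170041,
    2319519966496971546801499390428298008737937105492967583805986727654702549399628500200082845,
    2550837909457175412637109457167430042261761401525331253398844879801018436506390599839027651,
    2819144312353063162279252826465326771141857141084700856547712402953694406488269799222190351,
    151186565524389809524970818923559211191350599357908684942128136016034826621738858765114846,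
    3084217739172132887341403220693063891869504579240412696753666035007700035604040085018814643,
    3839464605302381627405011155512688793338782813079000921692144756554298805918356420468724217,
    4551197300699185986169425133531050049363217021656607975011880098236697116491297709122702729,
    728463371826102691675931748984506874576337470951922265232381078855045374414907952906444308,
    5240615764618019237972147106983539049452117536979181801042803550315805037008643685683829876,
    1791243829029879040836042579640421374293208597180781266163592228629918617101154706004154891,
    4719236597709659295431184445630876724659891575975790536813256909347651036729891809332836914,
    6525763584050467325393884928834452241965016434372679067978867522825677541639401587279455336,
    7230036835247500776007024598471285009487278719141820574928051230241455888984812197712008725,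
    8503808403551706514184037363257551189725567428228929722443638855656445858737519872136300701,
    10324077077094195781969348331622483285576651091669447216373439994992572291380752781472306768,
    10698872918750031051151158400466161242064923793398357089317225319296670576291903584804702396,
    1726833537655736194149297041589680003899999483467631499016773550488567940248289184748057728,
    2934662581553040263724549065950523551097770003779393787775708173754792693869936290821140550,
    5686965102844451679367439786339725981681864328328722251225900906937109183441198938189916755,
    3699843275947477950010575809089620956661996341412112333591864598401287152656625972981354649,
    5160297924078609239242049377964374010406364282561119559771317817450971631074043639648919971,
    11081999889116565557604952061880361273818887192441176203429681659627921518145633917338731954,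
    6129271936516328434318780438681643700651948206292895736827551787906399250981272334300625148,
    12183820858291189036996178307174223663008317756029013108077313821778448354191556549235876234,
    2303190411286817085518147083358854028489752463592164497673774788613484294661172128506221800,
    9045706281462764691949636802180133784725392322018633497264443626518178406022530199774726327,
    1215856855898913273874735897561304904190949854750522432654677672944689431558334661643494881,
    13713770859530328450000344100531589741544134408119708909872033410587416162474043215417922666,
    5099066331752808194569997127657952948538404938386940105421507185518688147307711408613903686,
    1278941043685069087333292449358570859451294878755732215834059410911218194810831212481969254,
    1787195690149175891287444390688743194411427634917616101612294042271757288865022123585851829,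
    5937236816939119192988298777121245316056102329363632720462675784409759956360384080002063649,
    6326398311623911967857775276868366738673935938865889216928784707358840668062460840753789103,
    5103407587628860838548220582416530672710016022430192212662781983804484161416166064431639985,
    4612188341992213872140878801560373644943127084224846665102093335501653320369641354142260550,
    6661463005141522190539530626025867038882240796284292100579100959683023928217698352938253635,
    4608143755633951904489746415200132301228913412719032881218250539193506845000623386740214343,
    6574365315898747984912550451621765823906334520686109613949102512634587497498022727135580657,
    1366718837489304266978934380745351613591070318572583107201494221293940528030097269641599461,
    6212399118203597817236540625038701096763443726007740486531555497625974620481769174138984778,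
    5290606437736311773514545577384723119704296361781183625325720567064848626610083705905625418,
    708564332057752498527057973872906667422676562265100647534091890323000693008350891647541713,
    12421270265128324282294019846391367251662550660701983344708862892017783520371230287137519749,
    1169957440358780396240836843914705040642314803747637005858551873489003800809842524550270054,
    2578064541100088119986363862586865443496544950331479331039940431156597288008788504435275970,
    10403336554382765499461060425560313061365581294288997302306888320173620524605375139149942433,
    12449375189413794118958492441951542458904877671373539450072742686994038286522959514890266828,
    12291160337785927152579980501728374864578693213606260508066736979285486868168251113926616388,
    10970469463708048768197621698655364487534044751052179478387371697671902425251325821370685570,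
    11086331466154363696764735388871271143148676218206594547625278090847760896265103532636177518,
    1726716612323139002880098032229721475857434586543029242745847121835805080406864495066036605,
    6282456693373896296109675559741558497626556964744505480555985340500712113001374001578311232,
    10920359904112237930148946866681342769158438224437863833191457091312677337560483047385680215,
    12266873958385099227481724077930678797211571655904160883057543486970739706848878391655041586,
    5051079629643263588618974604831031360837395124902580153121125122380081902305982005296316576,
    9522078770772317218850832162325244861145533379323597790927224118885763817920133295450012977,
    1229335483454870981681143969374615409637071261661400635627913474824266601814863102345241987,
    12171441305788127995658536620089084278522732882472431513147540207765058281493693421208106496,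
    7549741316899042389266491832446772225947744160563294018352118183644943221422140911452807726,
    7550748956497839950876484991170300442646842771457780188175234175138141500443044945035649398,
    7590650828576887208558927012263941252000481140180570558115371550446104758394007556595391853,
    7606075923003337493408470973814368969845832874408749513316814964792605185565853008220777832,
    7662767794506142393963666935202795653533599514579783818514901949928432023817507426367823034,
    1914222643174831899779084224723484795709751448974742791421706378145543427107364620058794118,
    12485996064749448705333474375824800806468395551051565449137044530887241073593837412277243014,
    8226980088711597611978762417121441021892660868301810875650866281768574543833032977218174381,
    12453246117262485518948664347999617526351550269069197767655557885802799535652274150073648698,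
    10157270357009261255755180531465040778897647281932444098585155966340738337690591588186787493,
    5499783807412035295194626145238728514323934550803650794542396755378943453727973862075812505,
    12435709302650928286722167231393922009584308948925739271657369281700073179635562943150119130,
    13207624846857920558953718115297623773487107231777842776266860068999818289239306929109142753,
    6647240362502217549637247199455891228961653505556764471198238338427235918296771881726027481,
    4142276038554567004230193848794906582286208490526373922220312378235088888715212632957175902,
    206034142458579937761850636251260924460381328357257618871077427507855281847070065631497352,
    13454090528892625832469897725538681491384887107841176110552634029884635701001225399110264426,
    4078551528728836004383948394363890472057031594758769018115966015880730820847705186153047286,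
    2116361002749203979056529045166086016430189844355361124033469351278558092354137787188402894,
    10698921422506535232079906451292463395591415101685297590733820665483126282633798468332361968,
    5743411024330552499189706870845073316520401812882390347887583125516705864893722077554173146,
    4407162576471169802999299704518372065272172096247186140737429592854462639001422117966265969,
    4432410838638012161028825956651403071830614181820159357259541262961706594978310710436632176,
    7273183954571368594887548766264137122748307170868569509830982725615503325408195422766382701,
    3928362090444641569424235766120772645233530402864565183822509646243494990708144735517229469,
    4470756603613820593478146919923689384482761443678210920614187696010759685503363255043684069,
    6598879598456518881847516690225056790222567700640909864460509765472687042079576866776251704,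
    7272441909229037918249470231702027699537912941168228988580978647433967174156520283754929795,
    10384625354773629282730654167672740590417139673187308578520656752687639165272762206075836024,
    9654855515268814040051784573236680643191996009370499332262640278020717095694801082550627683,
    4946255275336747721663956604548086168958936070544917694594708157998100573663846098798135927,
    4471690409047367199297017765641674212723708423442038634348532976895477169013368178445275552,
    6909703109363848127792108531953278536222957208055459048703913542401862801762944889801272502,
    3228761620767777672865281644308860536401646132640790151758233646488465218197746562044154570,
    3164477160718161669842147601949091711487595938118020844506866214961342283716482390523143812,
    11118804834880982672201191321162795782475745856808033163156962518378370488332502953314439860,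
    1978852932160932753504579851017799034808973555535070019622455715821256649522813880128149203,
    2567995597515076638931293229320725542304133633136148501081264710920583326487369716280654516,
    10844153825988876206694293816715194895760984104385247392772754817282407431462236639371830514,
    742897239393466448659801559598308943901113287951874347973852827053054583722304324132055623,
    10354973232881190134830294635038970746570723886506759567817655349280632967349866325023568559,
    10602021091195979891901930915586491642383034772217144510646862007246023531280393017704923859,
    10157085517339327563992185004804591038133368744608948798786667862676812089401817654174004569,
    9369636872185341959344587752556837155159042040299082160870340944396825150960820406337975437,
    11755801114488867072617563209557498774911804256003476312746493343489552364157934898778377501,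
    12636076353590237581536273277848897935753145050113748506105264887475915709078316822296729133,
    10397808175096049705166143579969361765237541995675719716405460230529733545949010495859667311,
    12054245690590071022347278221250867957446652019857035391864728044573736771254703431940074676,
    12578807920010232090351298915137230490789794164278772968704648144582649250940784252874772862,
    8445856054609757336625566028824589963628841188411217854538150333136770148522726137621738581,
    12555486227405454975909008009098767341985552716250102474164100176075215110713168666284836573,
    7156307763240593120411771899910537796555294187458548256245104463876048458985998331027208382,
    6244266735919526533465432104831236661777374025313618776210299088987694175522584289535501635,
    9715600954790217425309170483578152997754490017459938580599045657822898794620791535750461141,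
    6824787612147093171100613311402554782544748789864360788802604919329036459082607207353311461,
    3145326472945050458776178506724527713978742607740015776243510089020219734028425704520658181,
    10097838487834714323740960718706193884080624027469083482364847014134706985134811716004821398,
    9697250479054179547266162228073336850998209825928426622272575010750340569896573384391765436,
    5616905306330235559903918552871823888121889190900386798262246138867530121166487664055753402,
    9965254604736484272052373709952652134720385225826106734161218488467783770574164111923908757,
    8599175428434655899269913339237397177430620465981853318246618921735667722184920218455929392,
    2505588559069974341571877548613135512069300280881341115642066921950994530066385455374977466,
    10904830124559270859359773727105208203793612261003372005235252220764196004034959128275388027,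
    8546440374252475571422057628578981302733516379665717363852759946944158042835488864559732132,
    8695899360387331666618388174672425467585258229944191077116961140844918676303546190121277862,
    10465006538556837301175993859019906095753242095126074356976263788196426304613374948827876930,
    1698999375570419350696403322009294713455128430747563147054488575380686006987570579625858537,
    10954932975995945073276410815938615187436426840221623520231111582292221129017901282369370732,
    11169214832317524021349983832167012635962020147129662804225126521585510702382676142951917696,
    9838064947303933373335339072619733233163386935834704515889214685367351952389011090600803596,
    12828344473428782479441980419721581321608495528883961965464442432752279074722382475294823764,
    8105834432788168740736982792659049804561409102161400992346324106583826901440275980176008330,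
    2175935478679723159463661730901631416482211163434719704836768943634458200682014850562522238,
    8614526287176785073612771321168957156708528895132256747899582181896324884017241344489583782,
    4981952299866136311115417254546804687493977515667988204956888067304720389190573721710629204,
    12037105648778455041831653432461441848761088928101753970558977561571350886725097250125664767,
    13468145884392250427301998605241198799658883896892552996874048759101938242065560396575721576,
    5809177370564133001994779996446204205235983955896286133268395697816254975040605015694853666,
    11032258834379938898458669361877977610455139462679309156419623824138264111250190582414906854,
    5749509302202610758009982113493057952810642848888656353578978969485487608093366338088735040,
    12833016511500792521195364739490066783417879615966253220836855885182689057274777255931374926,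
    1863243758325541890477941437202448242434331080858739820827644939067001456796430272832417418,
    12928238762621720119897093714421690779992205856517785423468402420427683971676692921264521553,
    12940241734933433437372606342790717089531649688422390161042183428913895679267518078156147156,
    7209158215328473626887984240125526221095428938770634313033139197612996760504560028813389343,
    5514097767592024804003277819716644731155786217192224077178403713714240383793281014453972482,
    1617943426848541386653126602721426921476093716544745302338732606711536386287575973673172096,
    2495650852029560427030119789696044275343225194904458978653763370425456024618761957424123068,
    2704343851267237005596277105697838793203101289610464686054662003308180264897663406347875969,
    10529455316581516274841465579055708851493193869949240920281488656317384477403287363152020640,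
    11056134576997800913643242145032907938983255629229870573593964575063682544573140817280052375,
    6635438926944103895443336293585081035039069987855992013009442182880194161114774353837003174,
    14802231604204408474172200695300843129337248559794192656267555146060388948917445674277772835,
    6646380489783378679445108214348039128381237056804064418867020998665117798534730609044201858,
    15045237748184683118366036741166068679418455180073816739934411076656240259239261187108536446,
    15062692723722399309988894734054895009523290393238472481319718389189342670380102630663500199,
    5607534558621575908456668081917171042387486486146240373742395141111920212208678372912087248,
    9687886078697081766061477655930910795082899575550989871149897705307444871659517525834666546,
    14850019411974279333572181919299661972103593063047870448052003779150215353740181459246501507,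
    15890004978224218148631752764125455996583909801643960839741594847109801790718803798414475424,
    15986423823751423692745563752599839785172643658958033898316697173353239226152905468664754364,
    16199402861621710127119830735717458132034209948464438802481445626674468444281430013850462556,
    16445056473672557137243011001028909214022561470871629437608492222645639934654082642095634624,
    16619517367983201959093581228679434077871754372879904186362866983947831712609268045355682515,
    16828580100472685116612670892229923794776971234776714632472731264017511130153421740386293188,
    7349700258802523137090386701590835]

/-- Cosets in a chain of subgroups generated by conjugates of `(abc)⁵`. -/
def scriptL : Script where
  ng := 43
  w := 4
  defBase := 1024
  defSplit := 64
  defs := [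
    201900310460034420605442892802]
  dedBase := 16384
  dedSplit := 1024
  deds := [
    7442984913153787643711621711412037088003694995940036229435841011219802053855589257216001,
    16742942894985193094526932241569418837003736160072583514659244238140617942807012658338501,
    10350996026146411310581589310460482769247403787843227759428250923231329395738473125388064,
    9335786769937607126575747416083113613299590711441599182817048957158813019630177103909976,
    96262488]

/-- Cosets in a chain of subgroups generated by conjugates of `(abc)⁵`. -/
def scriptM : Script where
  ng := 43
  w := 4
  defBase := 1024
  defSplit := 64
  defs := [
    775129288194005892766503966625807]
  dedBase := 16384
  dedSplit := 1024
  deds := [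
    19478142197247894637490190213791410374289835871127672098967212139529573282492925861724161,
    14612984627733322620124930354443828911554692289811691467883093681970]

/-- Cosets in a chain of subgroups generated by conjugates of `(abc)⁵`. -/
def scriptD : Script where
  ng := 43
  w := 3
  defBase := 512
  defSplit := 64
  defs := [
    13296733739]
  dedBase := 8192
  dedSplit := 1024
  deds := [
    2712660834017281]

/-- Cosets in a chain of subgroups generated by conjugates of `(abc)⁵`. -/
def scriptE : Script where
  ng := 43
  w := 3
  defBase := 512
  defSplit := 64
  defs := [
    32]
  dedBase := 8192
  dedSplit := 1024
  deds := [
]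

/-- The word `w⁻¹ (abc)⁵ w` for the entry `w` of `conjWords` with number `i`. -/
def conjWord (i : ℕ) : List ℕ :=
  (conjWords.getD i []).reverse ++ (zWord ++ conjWords.getD i [])

/-- The words in the centralizer of `(abc)⁵` that witness the relations `conjTriples`. -/
def conjChecks : List (List ℕ) :=
  conjTriples.flatten.map fun t =>
    conjWords.getD t.2.1 [] ++ (conjWord t.1 ++ (conjWords.getD t.2.2 []).reverse)

/-- The words in the centralizer of `(abc)⁵` that witness the relations `normTriples`. -/
def normChecks : List (List ℕ) :=
  normTriples.map fun t =>
    t.1 ++ ((t.2.1.flatMap conjWord).reverse ++ (conjWords.getD t.2.2 []).reverse)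

set_option maxRecDepth 100000

lemma scriptV_run : scriptV.run (lookRules [relRules]) (checkK 4 7 [0, 1, 2] 120
    ((zWord ++ zWord) :: [0, 1, 2].map fun x => x :: (zWord ++ x :: zWord))) = true := by
  decide +kernel

lemma scriptW_run :
    scriptW.run (lookRules [relRules, zRules]) (checkK 4 6 [0, 1, 2] 60 []) = true := by
  decide +kernel

lemma scriptQ_run : scriptQ.run (lookRules [relRules, zRules, vRules])
    (checkK 4 6 [0, 1, 2, 3] 57 []) = true := by
  decide +kernel

lemma scriptP_run : scriptP.run (lookRules [relRules, vRules])
    (checkK 4 13 [] 5184 (centWords.map fun l => l ++ (zWord ++ l.reverse))) = true := by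
  decide +kernel

lemma scriptC_run : scriptC.run (lookRules [relRules, cRules])
    (checkK 4 11 [] 1463 (conjChecks ++ normChecks)) = true := by
  decide +kernel

lemma scriptN_run : scriptN.run
    (lookConj [18, 16, 20, 31, 34, 28, 36, 19, 1, 13, 9, 22] conjTriples)
    (checkK 43 9 [18, 37, 31] 266 []) = true := by
  decide +kernel

lemma scriptL_run : scriptL.run (lookConj [31, 34, 39, 19] conjTriples)
    (checkK 43 4 [18, 16, 20, 31, 34, 28, 36, 19, 1, 13, 9, 22] 11 []) = true := by
  decide +kernel

lemma scriptM_run : scriptM.run (lookConj [31, 34] conjTriples)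
    (checkK 43 4 [31, 34, 39, 19] 12 []) = true := by
  decide +kernel

lemma scriptD_run : scriptD.run (lookConj [31] conjTriples)
    (checkK 43 3 [31, 34] 5 []) = true := by
  decide +kernel

lemma scriptE_run : scriptE.run (lookConj [] conjTriples) (checkK 43 3 [31] 2 []) = true := by
  decide +kernel

lemma rules_follow : ∀ l ∈ [relRules, zRules], ∀ R ∈ l, R.Follows 4 (zWord :: relWords) [] := by
  decide +kernel

lemma relRules_follow : ∀ R ∈ relRules, R.Follows 4 relWords [] := by
  decide +kernel

lemma vRules_follow : ∀ R ∈ vRules, R.Follows 4 [] [[0], [1], [2]] := by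
  decide +kernel

lemma cRules_follow : ∀ R ∈ cRules, R.Follows 4 [] ([0] :: [1] :: [2] :: centWords) := by
  decide +kernel

lemma conjTriples_lt : ∀ l ∈ conjTriples, ∀ t ∈ l, t.1 < 43 ∧ t.2.1 < 43 ∧ t.2.2 < 43 := by
  decide +kernel

lemma normChecks_lt : ∀ l ∈ conjChecks ++ normChecks, ∀ x ∈ l, x < 4 := by
  decide +kernel
/-- The action on 266 points. -/
def tableJ : ℕ := Nat.ofDigits (10 ^ 90) [
  483851416860126517226576230062603632677556784570441051105413480099609907091379775132972170,
  806090015081558883783980938833510217004904288887475448709911226667656105875714541249594516,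
  106954637814422591068641943848782689881543379396453734086507344106317161013501725855384184,
  205912279343516114628834752546551302800242617059068673030686004123764086481898905586097165,
  561803053373432753343480957234976143428633067436566452046944466269039173165358947428703147,
  318526756412671055336863118550725241072503160929283283626009969531712325269306698687571793,
  428380086720846603910874066460379639723138807060373469315912204745847902948676773425589732,
  618250033419083267605009690592868601729561072791790314879165328690059518883074954832231064,
  672802743429818348445577551116087864945624550944211286086918114637904563666484062233152276,
  225745272536214949251928592883327783021039906096829680918052802831420627715872531945627461,
  19593495374472798615828797531008231380674705946376906901658718484787265733274142485919535,
  274594559189088485379678531648034735698401048567559367486243977592306613202744681266110198,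
  2680990447660731701786080421242605970971426348463422737445387527140435680487778564121097,
  861806167250539489998536338363882309309802614685882019749264038248104511092275521368183849,
  258950249393491390739276239462527688962872712710430497160299413283239175049174646767576161,
  127242125725482156989569467806028483023361137943488054422250371795213217245082770406543092,
  234053291564454052245604283393555801144111068345863325361774698622057162710516828516306569,
  407118886347506629903643069701526687134966458651209402354124148169282025294812315739383971,
  425488323082953071857661988365580693185773557401986635183602844737277463289610061686489193,
  756577904244114628935153379115278029839613464397136647345602438361091854394470718876942054,
  601338240761731594531713314267492220255132658184836935939015117571413275959229132226200873,
  432068606595684731650772364724839583128264317060280641815245640739133284132890725996398623,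
  31034747648970598878692472099451369318617608623120361106336360657229350249847054147597188,
  652003801515706443712816449074522246316239949687214993349062040633332177834448321644114405,
  303899686430334840399922493719989976124171387281161519129603638941751974544695897709814260,
  368772882485192669259760066259046548517251285731668145231509919954456009631638427112041527,
  517434141459805005044200367396611213160351856610126022300256859196941782913517205254367900,
  29817086016084380459767436917836542184247850311362768316883111361243817340140412806220820,
  856209892517048681571539186567212274886241325743943129021530925628021560006328914382000832,
  584297365734497208114480201746875121530781633058785105534595559864341736212101445111501167,
  448093719783612190376893536799490184265350700318811168859014854355516523701785480169601629,
  792901456059964130423340265433979228908730856919941725731856241022017945281466895807856488, 237]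

/-- The action on 57 points. -/
def tableL : ℕ := Nat.ofDigits (10 ^ 90) [
  932590125497034618699113863769064510458257597724199010528912331456800312365844464073707585,
  18605043120387074226520864130459346977323601670352505606361056978904830019825230700063679,
  659222201528244066350350099757830573330933596262777083329510508675217152712904157570715286,
  851743598798366130187410608568944867440516948257107768359750090630647511099076796706446621,
  5422846610149799853741640832911747619654754820913949]

section Generators

/-- The generators of `G`, indexed by natural numbers. -/
def gen : ℕ → G
  | 0 => ga
  | 1 => gb
  | 2 => gc
  | 3 => gd
  | _ => 1

lemma gen_mul_self (x : ℕ) : gen x * gen x = 1 := by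
  have h : ∀ r ∈ rels, PresentedGroup.mk rels r = 1 := fun r hr => PresentedGroup.one_of_mem hr
  have h1 := h (a ^ 2) (by simp [rels])
  have h2 := h (b ^ 2) (by simp [rels])
  have h3 := h (c ^ 2) (by simp [rels])
  have h4 := h (d ^ 2) (by simp [rels])
  rw [pow_two, map_mul] at h1 h2 h3 h4
  rcases x with _ | _ | _ | _ | x
  exacts [h1, h2, h3, h4, one_mul 1]

lemma wordVal_relWords : ∀ l ∈ relWords, wordVal gen l = 1 := by
  have h : ∀ r ∈ rels, PresentedGroup.mk rels r = 1 := fun r hr => PresentedGroup.one_of_mem hr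
  have h1 := h ((a * b) ^ 5) (by simp [rels])
  have h2 := h ((b * c) ^ 3) (by simp [rels])
  have h3 := h ((c * d) ^ 5) (by simp [rels])
  have h4 := h ((a * c) ^ 2) (by simp [rels])
  have h5 := h ((a * d) ^ 2) (by simp [rels])
  have h6 := h ((b * d) ^ 2) (by simp [rels])
  have h7 := h ((b * c * d) ^ 5) (by simp [rels])
  simp only [pow_succ, pow_zero, one_mul, map_mul, mul_assoc] at h1 h2 h3 h4 h5 h6 h7
  simp only [relWords, List.forall_mem_cons, wordVal_cons, wordVal_nil, mul_one]
  exact ⟨h1, h2, h3, h4, h5, h6, h7, by simp⟩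

lemma closure_gen : Subgroup.closure (gen '' {x | x < 4}) = ⊤ := by
  rw [eq_top_iff, ← PresentedGroup.closure_range_of rels, Subgroup.closure_le]
  rintro _ ⟨i, rfl⟩
  apply Subgroup.subset_closure
  fin_cases i
  exacts [⟨0, by simp, rfl⟩, ⟨1, by simp, rfl⟩, ⟨2, by simp, rfl⟩, ⟨3, by simp, rfl⟩]

end Generators

section Permutations

/-- The image of a point under a generator in a packed table; undefined entries fix the point. -/
noncomputable def stepK (w T x i : ℕ) : ℕ := Nat.rec i (fun v _ => v) (entry 4 w T i x)

/-- Do two words act in the same way on the points below `n`? -/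
noncomputable def eqOnK (w T : ℕ) (l l' : List ℕ) (n : ℕ) : Bool :=
  Nat.rec (motive := fun _ => Bool) true (fun i ih => traceK 4 w T l
    (fun s => traceK 4 w T l' (fun s' => guardB (Nat.beq s s') ih) i) i) n

/-- The generators act by the permutations of the table `T` on `n` points. -/
structure IsAction (f : G →* Equiv.Perm ℕ) (w T n : ℕ) : Prop where
  gen : ∀ x < 4, ∀ i, f (gen x) i = stepK w T x i
  fix : ∀ x < 4, ∀ i ≥ n, f (Stmt15.gen x) i = i

lemma traceK_foldl {w T : ℕ} {f : ℕ → Bool} : ∀ {l : List ℕ} {i : ℕ},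
    traceK 4 w T l f i = true → f (l.foldl (fun i x => stepK w T x i) i) = true
  | [], _, h => h
  | x :: l, i, h => by
    have h' : (Nat.rec false (fun m _ => traceK 4 w T l f m) (entry 4 w T i x) : Bool) = true := h
    rw [List.foldl_cons, stepK]
    rcases he : entry 4 w T i x with _ | v
    · rw [he] at h'; simp at h'
    · rw [he] at h'
      exact traceK_foldl h'

lemma eqOnK_spec {w T : ℕ} {l l' : List ℕ} {n : ℕ} (h : eqOnK w T l l' n = true) : ∀ i < n,
    l.foldl (fun i x => stepK w T x i) i = l'.foldl (fun i x => stepK w T x i) i := by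
  induction n with
  | zero => simp
  | succ n ih =>
    have h1 := traceK_foldl (show traceK 4 w T l (fun s => traceK 4 w T l'
      (fun s' => guardB (Nat.beq s s') (eqOnK w T l l' n)) n) n = true from h)
    have h' := traceK_foldl h1
    rw [guardB_iff] at h'
    intro i hi
    rcases Nat.lt_succ_iff_lt_or_eq.1 hi with hi | rfl
    · exact ih h'.2 i hi
    · exact Nat.eq_of_beq_eq_true h'.1

lemma stepK_of_le {w T n x i : ℕ} (hT : T < 2 ^ (w * (n * 4))) (hi : n ≤ i) :
    stepK w T x i = i := by
  have : entry 4 w T i x = 0 := by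
    rw [entry_eq, Nat.shiftRight_eq_div_pow, Nat.div_eq_of_lt, Nat.zero_mod]
    exact hT.trans_le (Nat.pow_le_pow_right (by norm_num) (Nat.mul_le_mul_left _ (by omega)))
  simp [stepK, this]

lemma exists_isAction {w T n : ℕ} (hT : T < 2 ^ (w * (n * 4)))
    (hinv : ∀ x < 4, eqOnK w T [x, x] [] n = true)
    (hrel : ∀ l ∈ relWords, eqOnK w T l.reverse [] n = true) :
    ∃ f : G →* Equiv.Perm ℕ, IsAction f w T n := by
  have hinv' : ∀ x < 4, Function.Involutive (stepK w T x) := by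
    intro x hx i
    rcases lt_or_ge i n with hi | hi
    · exact eqOnK_spec (hinv x hx) i hi
    · rw [stepK_of_le hT hi, stepK_of_le hT hi]
  let σ : Fin 4 → Equiv.Perm ℕ := fun x => (hinv' x x.2).toPerm
  have hσ : ∀ (l : List (Fin 4)) (i : ℕ), (l.map σ).prod i =
      (l.map Fin.val).reverse.foldl (fun i x => stepK w T x i) i := by
    intro l i
    induction l with
    | nil => rfl
    | cons x l ih =>
      rw [List.map_cons, List.prod_cons, Equiv.Perm.mul_apply, ih, List.map_cons,
        List.reverse_cons, List.foldl_append]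
      rfl
  have hfix : ∀ (l : List ℕ) (i : ℕ), n ≤ i → l.foldl (fun i x => stepK w T x i) i = i := by
    intro l i hi
    induction l with
    | nil => rfl
    | cons x l ih => rw [List.foldl_cons, stepK_of_le hT hi, ih]
  have hone : ∀ l : List (Fin 4), (l.map Fin.val) ∈ relWords → (l.map σ).prod = 1 := by
    intro l hl
    ext i
    rw [hσ]
    rcases lt_or_ge i n with hi | hi
    · exact eqOnK_spec (hrel _ hl) i hi
    · exact hfix _ _ hi
  have hsq : ∀ x, σ x * σ x = 1 := fun x => Equiv.ext fun i => hinv' x x.2 i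
  have h1 := hone [0, 1, 0, 1, 0, 1, 0, 1, 0, 1] (by decide)
  have h2 := hone [1, 2, 1, 2, 1, 2] (by decide)
  have h3 := hone [2, 3, 2, 3, 2, 3, 2, 3, 2, 3] (by decide)
  have h4 := hone [0, 2, 0, 2] (by decide)
  have h5 := hone [0, 3, 0, 3] (by decide)
  have h6 := hone [1, 3, 1, 3] (by decide)
  have h7 := hone [1, 2, 3, 1, 2, 3, 1, 2, 3, 1, 2, 3, 1, 2, 3] (by decide)
  simp only [List.map_cons, List.map_nil, List.prod_cons, List.prod_nil, mul_one]
    at h1 h2 h3 h4 h5 h6 h7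
  have hrels : ∀ r ∈ rels, FreeGroup.lift σ r = 1 := by
    simp only [rels, Set.mem_insert_iff, Set.mem_singleton_iff]
    rintro r (rfl | rfl | rfl | rfl | rfl | rfl | rfl | rfl | rfl | rfl | rfl) <;>
    simp only [pow_succ, pow_zero, one_mul, map_mul, mul_assoc, a, b, c, d,
      FreeGroup.lift_apply_of]
    exacts [hsq 0, hsq 1, hsq 2, hsq 3, h1, h2, h3, h4, h5, h6, h7]
  refine ⟨PresentedGroup.toGroup hrels, ?_⟩
  have hgen : ∀ x < 4, ∀ i, PresentedGroup.toGroup hrels (gen x) i = stepK w T x i := by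
    intro x hx i
    have h : ∀ y : Fin 4, PresentedGroup.toGroup hrels (PresentedGroup.of y) i = stepK w T y i :=
      fun y => by rw [PresentedGroup.toGroup.of]; rfl
    interval_cases x
    exacts [h 0, h 1, h 2, h 3]
  exact ⟨hgen, fun x hx i hi => by rw [hgen x hx, stepK_of_le hT hi]⟩

namespace IsAction

variable {f : G →* Equiv.Perm ℕ} {w T n : ℕ}

lemma wordVal_apply (h : IsAction f w T n) {l : List ℕ} (hl : ∀ x ∈ l, x < 4) (i : ℕ) :
    f (wordVal Stmt15.gen l) i = l.reverse.foldl (fun i x => stepK w T x i) i := by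
  induction l with
  | nil => simp
  | cons x l ih =>
    rw [wordVal_cons, map_mul, Equiv.Perm.mul_apply, ih fun y hy => hl y (by simp [hy]),
      h.gen x (hl x (by simp)), List.reverse_cons, List.foldl_append]
    rfl

lemma wordVal_fix (h : IsAction f w T n) {l : List ℕ} (hl : ∀ x ∈ l, x < 4) {i : ℕ} (hi : n ≤ i) :
    f (wordVal Stmt15.gen l) i = i := by
  induction l with
  | nil => simp
  | cons x l ih =>
    rw [wordVal_cons, map_mul, Equiv.Perm.mul_apply, ih fun y hy => hl y (by simp [hy]),
      h.fix x (hl x (by simp)) i hi]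

lemma eq_of_eqOnK (h : IsAction f w T n) {l l' : List ℕ} (hl : ∀ x ∈ l, x < 4)
    (hl' : ∀ x ∈ l', x < 4) (he : eqOnK w T l.reverse l'.reverse n = true) :
    f (wordVal Stmt15.gen l) = f (wordVal Stmt15.gen l') := by
  ext i
  rcases lt_or_ge i n with hi | hi
  · rw [h.wordVal_apply hl, h.wordVal_apply hl', eqOnK_spec he i hi]
  · rw [h.wordVal_fix hl hi, h.wordVal_fix hl' hi]

end IsAction

end Permutations
section Divisibility

lemma dvd_card_of_period {H : Subgroup (Equiv.Perm ℕ)} [Finite H] {σ : Equiv.Perm ℕ} (hσ : σ ∈ H)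
    {p k i : ℕ} (hp : p.Prime) (h1 : (σ ^ p ^ (k + 1)) i = i) (h0 : (σ ^ p ^ k) i ≠ i) :
    p ^ (k + 1) ∣ Nat.card H := by
  have := Fact.mk hp
  have hper : ∀ m, Function.IsPeriodicPt σ m i ↔ (σ ^ m) i = i := fun m => by
    rw [Function.IsPeriodicPt, Function.IsFixedPt, Equiv.Perm.iterate_eq_pow]
  rw [← Function.minimalPeriod_eq_prime_pow (fun h => h0 ((hper _).1 h)) ((hper _).2 h1)]
  apply Function.IsPeriodicPt.minimalPeriod_dvd
  rw [hper]
  have h : (⟨σ, hσ⟩ : H) ^ Nat.card H = 1 := pow_card_eq_one'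
  have h' : σ ^ Nat.card H = 1 := congrArg Subtype.val h
  rw [h', Equiv.Perm.one_apply]

lemma mul_self_of_mem_closure {Γ : Type*} [Group Γ] {S : Set Γ}
    (hc : ∀ x ∈ S, ∀ y ∈ S, x * y = y * x) (hs : ∀ x ∈ S, x * x = 1) :
    ∀ h ∈ Subgroup.closure S, h * h = 1 := by
  have := Subgroup.isMulCommutative_closure hc
  intro h hh
  induction hh using Subgroup.closure_induction with
  | mem x hx => exact hs x hx
  | one => exact one_mul 1
  | mul x y hx hy ihx ihy =>
    have hxy : x * y = y * x :=
      congrArg Subtype.val (mul_comm' (⟨x, hx⟩ : Subgroup.closure S) ⟨y, hy⟩)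
    rw [mul_assoc, ← mul_assoc y, ← hxy, mul_assoc, ihy, mul_one, ihx]
  | inv x _ ih => rw [← mul_inv_rev, ih, inv_one]

lemma two_pow_dvd_card {H : Subgroup (Equiv.Perm ℕ)} [Finite H] {S : Set (Equiv.Perm ℕ)}
    (hS : S ⊆ H) (hc : ∀ x ∈ S, ∀ y ∈ S, x * y = y * x) (hs : ∀ x ∈ S, x * x = 1)
    {es : List (Equiv.Perm ℕ)} (hes : ∀ e ∈ es, e ∈ Subgroup.closure S) {i : ℕ}
    (hne : es.Pairwise fun e e' => e i ≠ e' i) {k : ℕ} (hk : 2 ^ k < es.length) :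
    2 ^ (k + 1) ∣ Nat.card H := by
  have hle : Subgroup.closure S ≤ H := (Subgroup.closure_le H).2 hS
  have : Finite (Subgroup.closure S) := Finite.of_injective _ (Subgroup.inclusion_injective hle)
  refine dvd_trans ?_ (Subgroup.card_dvd_of_le hle)
  have : Fact (Nat.Prime 2) := ⟨Nat.prime_two⟩
  have hP : IsPGroup 2 (Subgroup.closure S) := fun g =>
    ⟨1, Subtype.ext (by simpa [pow_two] using mul_self_of_mem_closure hc hs g g.2)⟩
  obtain ⟨m, hm⟩ := IsPGroup.iff_card.1 hP
  rw [hm]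
  apply pow_dvd_pow
  by_contra! hlt
  have hnodup : es.Nodup := hne.imp fun h e => h (by rw [e])
  have hcard : es.length ≤ Nat.card (Subgroup.closure S) := by
    let F : Fin es.length → Subgroup.closure S := fun j => ⟨es.get j, hes _ (es.get_mem j)⟩
    have hF : Function.Injective F := fun x y hxy =>
      (List.nodup_iff_injective_get.1 hnodup) (congrArg Subtype.val hxy)
    simpa using Nat.card_le_card_of_injective F hF
  have : 2 ^ m ≤ 2 ^ k := Nat.pow_le_pow_right (by norm_num) (by omega)
  omega

/-- Conjunction of a test over a list. -/
noncomputable def allK {α : Type} (l : List α) (f : α → Bool) : Bool :=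
  List.rec (motive := fun _ => Bool) true (fun a _ ih => guardB (f a) ih) l

lemma allK_spec {α : Type} {f : α → Bool} : ∀ {l : List α}, allK l f = true →
    ∀ a ∈ l, f a = true
  | [], _ => by simp
  | a :: l, h => by
    obtain ⟨h1, h2⟩ := guardB_iff.1 (show guardB (f a) (allK l f) = true from h)
    intro b hb
    rcases List.mem_cons.1 hb with rfl | hb
    · exact h1
    · exact allK_spec h2 b hb

/-- Does the word `l` have a cycle of length `p ^ (k + 1)` through the point `i`? -/
noncomputable def periodK (w T : ℕ) (l : List ℕ) (p k i : ℕ) : Bool :=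
  guardB (traceK 4 w T (List.replicate (p ^ (k + 1)) l).flatten.reverse (fun s => Nat.beq s i) i)
    (traceK 4 w T (List.replicate (p ^ k) l).flatten.reverse (fun s => !Nat.beq s i) i)

/-- Do the words `ls` send the point `i` to different points? -/
noncomputable def distinctK (w T i : ℕ) (ls : List (List ℕ)) : Bool :=
  List.rec (motive := fun _ => Bool) true (fun l ls ih => guardB (traceK 4 w T l.reverse (fun s =>
    allK ls fun l' => traceK 4 w T l'.reverse (fun s' => !Nat.beq s s') i) i) ih) ls

lemma wordVal_replicate {Γ : Type*} [Group Γ] (g : ℕ → Γ) (l : List ℕ) (m : ℕ) :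
    wordVal g (List.replicate m l).flatten = wordVal g l ^ m := by
  induction m with
  | zero => simp
  | succ m ih => rw [List.replicate_succ, List.flatten_cons, wordVal_append, ih, pow_succ']

namespace IsAction

variable {f : G →* Equiv.Perm ℕ} {w T n : ℕ}

lemma of_traceK (h : IsAction f w T n) {l : List ℕ} (hl : ∀ x ∈ l, x < 4) {i : ℕ}
    {F : ℕ → Bool} (hF : traceK 4 w T l.reverse F i = true) :
    F (f (wordVal Stmt15.gen l) i) = true := by
  rw [h.wordVal_apply hl]
  exact traceK_foldl hF

lemma dvd_card (h : IsAction f w T n) {H : Subgroup (Equiv.Perm ℕ)} [Finite H] {l : List ℕ}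
    (hl : ∀ x ∈ l, x < 4) (hH : f (wordVal Stmt15.gen l) ∈ H) {p k i : ℕ} (hp : p.Prime)
    (hK : periodK w T l p k i = true) : p ^ (k + 1) ∣ Nat.card H := by
  obtain ⟨h1, h0⟩ := guardB_iff.1 hK
  have hmem : ∀ m, ∀ x ∈ (List.replicate m l).flatten, x < 4 := by
    intro m x hx
    obtain ⟨l', hl', hx⟩ := List.mem_flatten.1 hx
    rw [List.eq_of_mem_replicate hl'] at hx
    exact hl x hx
  replace h1 := Nat.eq_of_beq_eq_true (h.of_traceK (F := fun s => Nat.beq s i) (hmem _) h1)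
  replace h0 := h.of_traceK (F := fun s => !Nat.beq s i) (hmem _) h0
  rw [wordVal_replicate, map_pow] at h1 h0
  refine dvd_card_of_period hH hp h1 fun h' => ?_
  rw [h'] at h0
  simp at h0

lemma pairwise_ne (h : IsAction f w T n) {i : ℕ} : ∀ {ls : List (List ℕ)},
    (∀ l ∈ ls, ∀ x ∈ l, x < 4) → distinctK w T i ls = true →
    (ls.map fun l => f (wordVal Stmt15.gen l)).Pairwise fun e e' => e i ≠ e' i
  | [], _, _ => by simp
  | l :: ls, hl, hK => by
    obtain ⟨h1, h2⟩ := guardB_iff.1 (show guardB (traceK 4 w T l.reverse (fun s =>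
      allK ls fun l' => traceK 4 w T l'.reverse (fun s' => !Nat.beq s s') i) i)
        (distinctK w T i ls) = true from hK)
    rw [List.map_cons, List.pairwise_cons]
    refine ⟨?_, h.pairwise_ne (fun l' hl' => hl l' (by simp [hl'])) h2⟩
    intro e he
    obtain ⟨l', hl', rfl⟩ := List.mem_map.1 he
    have h3 := h.of_traceK (hl l' (by simp [hl']))
      (allK_spec (h.of_traceK (hl l (by simp)) h1) l' hl')
    intro heq
    rw [heq] at h3
    simp at h3

end IsAction

end Divisibility
section Tables

/-- The word `w⁻¹ z w` with `z = (abc)⁵`. -/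
def zConj (w : List ℕ) : List ℕ := w.reverse ++ (zWord ++ w)

/-- Words that commute with `(abc)⁵` and with each other in their action on 266 points. -/
def commWords : List (List ℕ) :=
  [zWord, zConj [3, 2, 1, 0, 1, 0, 2, 1, 0, 1, 3, 2, 3],
    zConj [3, 2, 1, 0, 1, 0, 3, 2, 1, 0, 1, 2, 3, 2, 1]]

/-- Words that must act trivially. -/
def trivWords : List (List ℕ) := [[0, 0], [1, 1], [2, 2], [3, 3]] ++ relWords

/-- Pairs of words with the same action on 266 points. -/
def pairsJ : List (List ℕ × List ℕ) :=
  trivWords.map (·, []) ++ centWords.map (fun l => (l ++ (zWord ++ l.reverse), zWord)) ++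
    commWords.flatMap fun l => commWords.map fun l' => (l ++ l', l' ++ l)

/-- Words `w` with a prime `p` and a point in a `p`-cycle of `z w⁻¹ z w`. -/
def cyclesJ : List (List ℕ × ℕ × ℕ) :=
  [([3], 3, 1), ([3, 2, 3], 5, 0), ([3, 2, 1, 0, 1, 3, 2, 3], 7, 0),
    ([3, 2, 1, 0, 1, 0, 2, 3, 2, 1, 0, 1, 3, 2, 3], 11, 0), ([3, 2, 1, 0, 1, 2, 3, 2, 3], 19, 0)]

/-- Products of the commuting involutions `a`, `c` and `(abc)⁵`. -/
def prodsV : List (List (List ℕ)) := [[], [[0]], [[2]], [zWord], [[0], [2]]]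

/-- Products of the commuting involutions `commWords`. -/
def prodsN : List (List (List ℕ)) := [] :: commWords.map ([·]) ++ [commWords.take 2]

lemma tableJ_check : force tableJ (fun T => guardB (Nat.ble (T + 1) (2 ^ (9 * (266 * 4)))) <|
    guardB (allK pairsJ fun q => eqOnK 9 T q.1.reverse q.2.reverse 266) <|
    guardB (allK cyclesJ fun q => periodK 9 T (zWord ++ zConj q.1) q.2.1 0 q.2.2) <|
    guardB (periodK 9 T [1, 2] 3 0 0) <| guardB (periodK 9 T [0, 1] 5 0 0) <|
    guardB (distinctK 9 T 1 (prodsV.map List.flatten)) <|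
    distinctK 9 T 1 (prodsN.map List.flatten)) = true := by
  decide +kernel

/-- Pairs of words with the same action on 57 points. -/
def pairsL : List (List ℕ × List ℕ) := (zWord :: trivWords).map (·, [])

/-- Products of the commuting involutions `a` and `c`. -/
def prodsL : List (List (List ℕ)) := [[], [[0]], [[2]]]

lemma tableL_check : force tableL (fun T => guardB (Nat.ble (T + 1) (2 ^ (6 * (57 * 4)))) <|
    guardB (allK pairsL fun q => eqOnK 6 T q.1.reverse q.2.reverse 57) <|
    guardB (periodK 6 T [0, 1, 2, 3] 3 1 0) <| guardB (periodK 6 T [0, 1] 5 0 2) <|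
    guardB (periodK 6 T [3, 2, 0, 1, 3, 2, 1, 3, 0, 1, 2] 19 0 0) <|
    distinctK 6 T 6 (prodsL.map List.flatten)) = true := by
  decide +kernel

end Tables
section Subgroups

lemma Rule.Follows.mono {ng : ℕ} {rs rs' ls ls' : List (List ℕ)} {R : Rule}
    (h : R.Follows ng rs ls) (hr : rs ⊆ rs') (hl : ls ⊆ ls') : R.Follows ng rs' ls' :=
  ⟨h.1, h.2.1, fun hb => hl (h.2.2.1 hb), fun hb => (h.2.2.2 hb).imp fun _ h => ⟨hr h.1, h.2⟩⟩

/-- The facet subgroup generated by `a`, `b` and `c`. -/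
def V : Subgroup G := Subgroup.closure (gen '' {y | y ∈ [0, 1, 2]})

/-- The element `(abc)⁵`. -/
def z : G := wordVal gen zWord

lemma gen_mem_V {x : ℕ} (hx : x ∈ [0, 1, 2]) : gen x ∈ V :=
  Subgroup.subset_closure ⟨x, hx, rfl⟩

lemma wordVal_mem {Γ : Type*} [Group Γ] {g : ℕ → Γ} {H : Subgroup Γ} {l : List ℕ}
    (h : ∀ x ∈ l, g x ∈ H) : wordVal g l ∈ H :=
  H.list_prod_mem (by simpa using h)

lemma z_mem_V : z ∈ V := wordVal_mem fun x hx => gen_mem_V (by revert x hx; decide)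

lemma card_V_le_and : (Finite V ∧ Nat.card V ≤ 120) ∧ z * z = 1 ∧
    ∀ x ∈ [0, 1, 2], gen x * (z * (gen x * z)) = 1 := by
  have hlook : IsLookup gen ⊥ 4 (lookRules [relRules]) :=
    isLookup_lookRules (loops := []) gen_mul_self wordVal_relWords (by simp)
      (fun l hl => by rw [List.mem_singleton.1 hl]; exact relRules_follow)
  obtain ⟨⟨t, ht⟩, hw⟩ := scriptV.check_spec gen_mul_self hlook scriptV_run (by decide) (by decide)
  refine ⟨card_le_of_cover (k := 1) ht ⟨inferInstance, by simp⟩, ?_⟩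
  simp only [List.forall_mem_cons, Subgroup.mem_bot, List.map_cons, List.map_nil, wordVal_append,
    wordVal_cons] at hw ⊢
  exact ⟨hw.1, hw.2.1, hw.2.2.1, hw.2.2.2.1, by simp⟩

instance : Finite V := card_V_le_and.1.1

lemma z_mul_self : z * z = 1 := card_V_le_and.2.1

lemma z_inv : z⁻¹ = z := inv_eq_of_mul_eq_one_left z_mul_self

lemma commute_gen_z {x : ℕ} (hx : x ∈ [0, 1, 2]) : Commute (gen x) z := by
  have h := card_V_le_and.2.2 x hx
  rw [← mul_assoc, mul_eq_one_iff_inv_eq, mul_inv_rev, inv_eq_of_mul_eq_one_left (gen_mul_self x),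
    z_inv] at h
  exact h.symm

end Subgroups
section Images

/-- The normal closure of `(abc)⁵`. -/
def N : Subgroup G := Subgroup.normalClosure {z}

instance : N.Normal := Subgroup.normalClosure_normal

lemma z_mem_N : z ∈ N := Subgroup.subset_normalClosure rfl

lemma wordVal_zConj (w : List ℕ) :
    wordVal gen (zConj w) = (wordVal gen w)⁻¹ * z * wordVal gen w := by
  rw [zConj, wordVal_append, wordVal_append, wordVal_reverse gen_mul_self, mul_assoc]
  rfl

lemma zConj_mem_N (w : List ℕ) : wordVal gen (zConj w) ∈ N := by
  simpa [wordVal_zConj] using Subgroup.Normal.conj_mem inferInstance z z_mem_N (wordVal gen w)⁻¹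

lemma finite_range_of_isAction {f : G →* Equiv.Perm ℕ} {w T n : ℕ} (h : IsAction f w T n) :
    Finite f.range := by
  have hfix : ∀ g : G, ∀ i, ¬ i < n → f g i = i := by
    intro g i hi
    have hg : g ∈ Subgroup.closure (gen '' {x | x < 4}) := by rw [closure_gen]; trivial
    have hle : Subgroup.closure (gen '' {x | x < 4}) ≤
        (MulAction.stabilizer (Equiv.Perm ℕ) i).comap f := by
      rw [Subgroup.closure_le]
      rintro _ ⟨x, hx, rfl⟩
      exact h.fix x hx i (not_lt.1 hi)
    exact hle hg
  have := Finite.of_equiv _ (Equiv.Perm.subtypeEquivSubtypePerm fun i => i < n)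
  let F : f.range → {σ : Equiv.Perm ℕ // ∀ i, ¬ i < n → σ i = i} := fun σ =>
    ⟨σ, by obtain ⟨_, g, rfl⟩ := σ; exact hfix g⟩
  exact Finite.of_injective F fun x y hxy => Subtype.ext (congrArg (fun s => s.1) hxy)

lemma finite_map_of_finite_range {f : G →* Equiv.Perm ℕ} [Finite f.range] (H : Subgroup G) :
    Finite (H.map f) :=
  Finite.of_injective _ (Subgroup.inclusion_injective (Subgroup.map_le_range f H))

lemma wordVal_flatten {Γ : Type*} [Group Γ] {g : ℕ → Γ} {H : Subgroup Γ} {ms : List (List ℕ)}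
    (h : ∀ l ∈ ms, wordVal g l ∈ H) : wordVal g ms.flatten ∈ H := by
  induction ms with
  | nil => exact H.one_mem
  | cons l ms ih =>
    rw [List.flatten_cons, wordVal_append]
    exact H.mul_mem (h l (by simp)) (ih fun l hl => h l (by simp [hl]))

lemma two_pow_dvd_card_of_isAction {f : G →* Equiv.Perm ℕ} {w T n : ℕ} (hf : IsAction f w T n)
    {H : Subgroup (Equiv.Perm ℕ)} [Finite H] {ls : List (List ℕ)}
    (hH : ∀ l ∈ ls, f (wordVal gen l) ∈ H)
    (hc : ∀ l ∈ ls, ∀ l' ∈ ls, f (wordVal gen l * wordVal gen l') =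
      f (wordVal gen l' * wordVal gen l))
    (hs : ∀ l ∈ ls, wordVal gen l * wordVal gen l = 1) {ps : List (List (List ℕ))}
    (hps : ∀ ms ∈ ps, ms ⊆ ls) (hlt : ∀ l ∈ ls, ∀ x ∈ l, x < 4) {i : ℕ}
    (hd : distinctK w T i (ps.map List.flatten) = true) {k : ℕ} (hk : 2 ^ k < ps.length) :
    2 ^ (k + 1) ∣ Nat.card H := by
  have hlt' : ∀ l ∈ ps.map List.flatten, ∀ x ∈ l, x < 4 := by
    intro l hl x hx
    obtain ⟨ms, hms, rfl⟩ := List.mem_map.1 hl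
    obtain ⟨m, hm, hx⟩ := List.mem_flatten.1 hx
    exact hlt m (hps ms hms hm) x hx
  let S : Set (Equiv.Perm ℕ) := (fun l => f (wordVal gen l)) '' {l | l ∈ ls}
  refine two_pow_dvd_card (S := S) (H := H) ?_ ?_ ?_ ?_ (hf.pairwise_ne hlt' hd)
    (by simpa using hk)
  · rintro _ ⟨l, hl, rfl⟩
    exact hH l hl
  · rintro _ ⟨l, hl, rfl⟩ _ ⟨l', hl', rfl⟩
    simpa using hc l hl l' hl'
  · rintro _ ⟨l, hl, rfl⟩
    simpa using congrArg f (hs l hl)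
  · intro e he
    obtain ⟨_, hl, rfl⟩ := List.mem_map.1 he
    obtain ⟨ms, hms, rfl⟩ := List.mem_map.1 hl
    refine wordVal_flatten (g := gen) (H := (Subgroup.closure S).comap f) fun l hl => ?_
    exact Subgroup.subset_closure ⟨l, hps ms hms hl, rfl⟩

lemma commute_a_c : gen 0 * gen 2 = gen 2 * gen 0 := by
  have h := wordVal_relWords [0, 2, 0, 2] (by decide)
  simp only [wordVal_cons, wordVal_nil, mul_one] at h
  rw [← mul_assoc, mul_eq_one_iff_eq_inv, mul_inv_rev,
    inv_eq_of_mul_eq_one_left (gen_mul_self 0), inv_eq_of_mul_eq_one_left (gen_mul_self 2)] at h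
  exact h

lemma exists_hom_J : ∃ f : G →* Equiv.Perm ℕ, 120 ∣ Nat.card (V.map f) ∧
    (175560 ∣ Nat.card (N.map f) ∧ Finite (N.map f)) ∧
    ∀ l ∈ centWords, f (wordVal gen l * (z * (wordVal gen l)⁻¹)) = f z := by
  have h := tableJ_check
  rw [force_eq] at h
  simp only [guardB_iff] at h
  obtain ⟨hT, hpairs, hcyc, h3, h5, hV, hN⟩ := h
  replace hT := Nat.le_of_ble_eq_true hT
  replace hpairs := allK_spec hpairs
  have htriv : ∀ l ∈ trivWords, eqOnK 9 tableJ l.reverse [] 266 = true := fun l hl =>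
    hpairs (l, []) (by simp [pairsJ, hl])
  obtain ⟨f, hf⟩ := exists_isAction hT
    (fun x hx => htriv [x, x] (by revert x; decide)) (fun l hl => htriv l (by simp [trivWords, hl]))
  have := finite_range_of_isAction hf
  have hVf := finite_map_of_finite_range (f := f) V
  have hNf := finite_map_of_finite_range (f := f) N
  have hlt : ∀ q ∈ pairsJ, (∀ x ∈ q.1, x < 4) ∧ ∀ x ∈ q.2, x < 4 := by decide +kernel
  have heq : ∀ q ∈ pairsJ, f (wordVal gen q.1) = f (wordVal gen q.2) := fun q hq =>
    hf.eq_of_eqOnK (hlt q hq).1 (hlt q hq).2 (hpairs q hq)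
  have hmemV : ∀ l : List ℕ, (∀ x ∈ l, x ∈ [0, 1, 2]) → f (wordVal gen l) ∈ V.map f :=
    fun l hl => ⟨_, wordVal_mem fun x hx => gen_mem_V (hl x hx), rfl⟩
  refine ⟨f, ?_, ⟨?_, hNf⟩, fun l hl => ?_⟩
  · have d3 := hf.dvd_card (H := V.map f) (by decide) (hmemV [1, 2] (by decide)) Nat.prime_three h3
    have d5 := hf.dvd_card (H := V.map f) (by decide) (hmemV [0, 1] (by decide)) Nat.prime_five h5
    have d8 := two_pow_dvd_card_of_isAction hf (H := V.map f) (ls := [[0], [2], zWord])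
      (fun l hl => hmemV l (by revert l; decide)) ?_ ?_ (by decide) (by decide) hV (k := 2)
      (by decide)
    · exact Nat.Coprime.mul_dvd_of_dvd_of_dvd (m := 24) (n := 5) (by decide)
        (Nat.Coprime.mul_dvd_of_dvd_of_dvd (m := 8) (n := 3) (by decide) d8 d3) d5
    · have h0 := commute_gen_z (x := 0) (by decide)
      have h2 := commute_gen_z (x := 2) (by decide)
      change gen 0 * wordVal gen zWord = wordVal gen zWord * gen 0 at h0
      change gen 2 * wordVal gen zWord = wordVal gen zWord * gen 2 at h2
      simp [-map_mul, commute_a_c, h0, h2]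
    · have hz := z_mul_self
      rw [z] at hz
      simp [gen_mul_self, hz]
  · have hcomm : ∀ l ∈ commWords, wordVal gen l ∈ N ∧ wordVal gen l * wordVal gen l = 1 := by
      have hz : ∀ w, wordVal gen (zConj w) * wordVal gen (zConj w) = 1 := by
        intro w
        simp only [wordVal_zConj, mul_assoc, mul_inv_cancel_left]
        rw [← mul_assoc z, z_mul_self, one_mul, inv_mul_cancel]
      simp only [commWords, List.forall_mem_cons]
      exact ⟨⟨z_mem_N, z_mul_self⟩, ⟨zConj_mem_N _, hz _⟩, ⟨zConj_mem_N _, hz _⟩, by simp⟩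
    have d8 := two_pow_dvd_card_of_isAction hf (H := N.map f) (ls := commWords)
      (fun l hl => ⟨_, (hcomm l hl).1, rfl⟩) (fun l hl l' hl' => ?_) (fun l hl => (hcomm l hl).2)
      (by decide) (by decide) hN (k := 2) (by decide)
    · have hd : ∀ q ∈ cyclesJ, q.2.1 ∣ Nat.card (N.map f) := by
        intro q hq
        have hp : ∀ q ∈ cyclesJ, q.2.1.Prime := by simp [cyclesJ]; norm_num
        have hq4 : ∀ q ∈ cyclesJ, ∀ x ∈ zWord ++ zConj q.1, x < 4 := by decide +kernel
        have := hf.dvd_card (H := N.map f) (hq4 q hq) ⟨_, ?_, rfl⟩ (hp q hq) (allK_spec hcyc q hq)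
        · simpa using this
        · rw [wordVal_append]
          exact N.mul_mem z_mem_N (zConj_mem_N _)
      simp only [cyclesJ, List.forall_mem_cons] at hd
      obtain ⟨e3, e5, e7, e11, e19, -⟩ := hd
      have c3 := Nat.Coprime.mul_dvd_of_dvd_of_dvd (by decide) d8 e3
      have c5 := Nat.Coprime.mul_dvd_of_dvd_of_dvd (by decide) c3 e5
      have c7 := Nat.Coprime.mul_dvd_of_dvd_of_dvd (by decide) c5 e7
      have c11 := Nat.Coprime.mul_dvd_of_dvd_of_dvd (by decide) c7 e11
      exact Nat.Coprime.mul_dvd_of_dvd_of_dvd (by decide) c11 e19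
    · have := heq (l ++ l', l' ++ l) (List.mem_append_right _
        (List.mem_flatMap.2 ⟨l, hl, List.mem_map.2 ⟨l', hl', rfl⟩⟩))
      simpa only [wordVal_append] using this
  · have := heq (l ++ (zWord ++ l.reverse), zWord)
      (List.mem_append_left _ (List.mem_append_right _ (List.mem_map.2 ⟨l, hl, rfl⟩)))
    simpa only [z, wordVal_append, wordVal_reverse gen_mul_self] using this

lemma exists_hom_L : ∃ f : G →* Equiv.Perm ℕ, f z = 1 ∧ 3420 ∣ Nat.card f.range ∧
    4 ∣ Nat.card ((Subgroup.closure {gen 0, gen 2}).map f) := by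
  have h := tableL_check
  rw [force_eq] at h
  simp only [guardB_iff] at h
  obtain ⟨hT, hpairs, h9, h5, h19, hA⟩ := h
  replace hT := Nat.le_of_ble_eq_true hT
  replace hpairs : ∀ l ∈ zWord :: trivWords, eqOnK 6 tableL l.reverse [] 57 = true := fun l hl =>
    allK_spec hpairs (l, []) (List.mem_map.2 ⟨l, hl, rfl⟩)
  obtain ⟨f, hf⟩ := exists_isAction hT (fun x hx => hpairs [x, x] (by revert x; decide))
    (fun l hl => hpairs l (by simp [trivWords, hl]))
  have := finite_range_of_isAction hf
  have hAf := finite_map_of_finite_range (f := f) (Subgroup.closure {gen 0, gen 2})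
  have h4 : 4 ∣ Nat.card ((Subgroup.closure {gen 0, gen 2}).map f) := by
    refine two_pow_dvd_card_of_isAction hf (ls := [[0], [2]]) ?_ ?_ ?_ (by decide) (by decide) hA
      (k := 1) (by decide)
    · simp only [List.forall_mem_cons]
      exact ⟨⟨gen 0, Subgroup.subset_closure (by simp), rfl⟩,
        ⟨gen 2, Subgroup.subset_closure (by simp), rfl⟩, by simp⟩
    · simp [-map_mul, commute_a_c]
    · simp [gen_mul_self]
  refine ⟨f, ?_, ?_, h4⟩
  · simpa [z] using hf.eq_of_eqOnK (l := zWord) (l' := []) (by decide) (by simp)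
      (hpairs zWord (by simp))
  · have d9 := hf.dvd_card (H := f.range) (by decide) ⟨_, rfl⟩ Nat.prime_three h9
    have d5 := hf.dvd_card (H := f.range) (by decide) ⟨_, rfl⟩ Nat.prime_five h5
    have d19 := hf.dvd_card (H := f.range) (by decide) ⟨_, rfl⟩ (by norm_num) h19
    have d4 := h4.trans (Subgroup.card_dvd_of_le (Subgroup.map_le_range f _))
    have c9 := Nat.Coprime.mul_dvd_of_dvd_of_dvd (by decide) d4 d9
    have c5 := Nat.Coprime.mul_dvd_of_dvd_of_dvd (by decide) c9 d5
    exact Nat.Coprime.mul_dvd_of_dvd_of_dvd (by decide) c5 d19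

end Images
section Conjugates

lemma conj_z_mem_V {l : List ℕ} (hl : l ∈ centWords) :
    wordVal gen l * (z * (wordVal gen l)⁻¹) ∈ V := by
  have hlook : IsLookup gen V 4 (lookRules [relRules, vRules]) := by
    refine isLookup_lookRules (loops := [[0], [1], [2]]) gen_mul_self wordVal_relWords ?_ ?_
    · simp only [List.forall_mem_cons, wordVal_cons, wordVal_nil, mul_one]
      exact ⟨gen_mem_V (by simp), gen_mem_V (by simp), gen_mem_V (by simp), by simp⟩
    · simp only [List.forall_mem_cons]
      exact ⟨fun R hR => (relRules_follow R hR).mono (by simp) (by simp),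
        fun R hR => (vRules_follow R hR).mono (by simp) (by simp), by simp⟩
  have h := (scriptP.check_spec gen_mul_self hlook scriptP_run (by simp) (by decide +kernel)).2
    (l ++ (zWord ++ l.reverse)) (List.mem_map.2 ⟨l, hl, rfl⟩)
  rwa [wordVal_append, wordVal_append, wordVal_reverse gen_mul_self] at h

lemma mem_centralizer_z : ∀ l ∈ [0] :: [1] :: [2] :: centWords,
    wordVal gen l ∈ Subgroup.centralizer {z} := by
  have hgen : ∀ x ∈ [0, 1, 2], wordVal gen [x] ∈ Subgroup.centralizer {z} := fun x hx => by
    rw [Subgroup.mem_centralizer_singleton_iff, wordVal_cons, wordVal_nil, mul_one]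
    exact commute_gen_z hx
  simp only [List.forall_mem_cons]
  refine ⟨hgen 0 (by simp), hgen 1 (by simp), hgen 2 (by simp), fun l hl => ?_⟩
  obtain ⟨f, hV, -, hf⟩ := exists_hom_J
  have hinj : Function.Injective (f.subgroupMap V) := by
    refine ((Nat.bijective_iff_surjective_and_card _).2 ⟨f.subgroupMap_surjective V, ?_⟩).1
    have : Nat.card (V.map f) ≤ Nat.card V := Nat.card_le_card_of_surjective _
      (f.subgroupMap_surjective V)
    have hpos : 0 < Nat.card (V.map f) :=
      have := Finite.of_surjective _ (f.subgroupMap_surjective V)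
      Nat.card_pos
    exact le_antisymm (card_V_le_and.1.2.trans (Nat.le_of_dvd hpos hV)) this
  have h : (⟨_, conj_z_mem_V hl⟩ : V) = ⟨z, z_mem_V⟩ := hinj (Subtype.ext (hf l hl))
  have h' : wordVal gen l * (z * (wordVal gen l)⁻¹) = z := congrArg Subtype.val h
  rw [← mul_assoc, mul_inv_eq_iff_eq_mul] at h'
  exact Subgroup.mem_centralizer_singleton_iff.2 h'

/-- The conjugates of `(abc)⁵` by the words `conjWords`. -/
def zc (i : ℕ) : G := wordVal gen (conjWord i)

lemma zc_eq (i : ℕ) : zc i = (wordVal gen (conjWords.getD i []))⁻¹ *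
    (z * wordVal gen (conjWords.getD i [])) := by
  rw [zc, conjWord, wordVal_append, wordVal_append, wordVal_reverse gen_mul_self, z]

lemma zc_mul_self (i : ℕ) : zc i * zc i = 1 := by
  rw [zc_eq]
  simp only [mul_assoc, mul_inv_cancel_left]
  rw [← mul_assoc z, z_mul_self, one_mul, inv_mul_cancel]

lemma checks_mem_centralizer : ∀ l ∈ conjChecks ++ normChecks,
    wordVal gen l ∈ Subgroup.centralizer {z} := by
  have hlook : IsLookup gen (Subgroup.centralizer {z}) 4 (lookRules [relRules, cRules]) := by
    refine isLookup_lookRules gen_mul_self wordVal_relWords mem_centralizer_z ?_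
    simp only [List.forall_mem_cons]
    exact ⟨fun R hR => (relRules_follow R hR).mono (by simp) (by simp),
      fun R hR => (cRules_follow R hR).mono (by simp) (by simp), by simp⟩
  exact (scriptC.check_spec gen_mul_self hlook scriptC_run (by simp) normChecks_lt).2

lemma conj_eq_of_mem_centralizer {Γ : Type*} [Group Γ] {u v s x : Γ}
    (h : v * (s⁻¹ * u⁻¹) ∈ Subgroup.centralizer {x}) :
    v⁻¹ * (x * v) = s⁻¹ * (u⁻¹ * (x * u)) * s := by
  rw [Subgroup.mem_centralizer_singleton_iff] at h
  have h1 : v = v * (s⁻¹ * u⁻¹) * (u * s) := by group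
  have h2 : x * v = v * (s⁻¹ * u⁻¹) * (x * (u * s)) := by
    rw [← mul_assoc _ x, h, mul_assoc x, ← h1]
  rw [h2]
  group

lemma zc_mul_zc_mul_zc : ∀ l ∈ conjTriples, ∀ t ∈ l, zc t.1 * zc t.2.1 * zc t.1 = zc t.2.2 := by
  intro l hl t ht
  have h := checks_mem_centralizer _ (List.mem_append_left _
    (List.mem_map.2 ⟨t, List.mem_flatten.2 ⟨l, hl, ht⟩, rfl⟩))
  rw [wordVal_append, wordVal_append, wordVal_reverse gen_mul_self] at h
  have hi := inv_eq_of_mul_eq_one_left (zc_mul_self t.1)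
  change _ * (zc t.1 * _) ∈ _ at h
  rw [← hi] at h
  have := conj_eq_of_mem_centralizer h
  rw [← zc_eq, ← zc_eq] at this
  rw [this, hi]
  simp only [mul_assoc, zc_mul_self, mul_one]
  rw [← mul_assoc, zc_mul_self, one_mul]

lemma conj_z_eq : ∀ t ∈ normTriples, (wordVal gen t.1)⁻¹ * (z * wordVal gen t.1) =
    (wordVal zc t.2.1)⁻¹ * zc t.2.2 * wordVal zc t.2.1 := by
  intro t ht
  have hflat : ∀ l : List ℕ, wordVal gen (l.flatMap conjWord) = wordVal zc l := by
    intro l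
    induction l with
    | nil => rfl
    | cons i l ih => rw [List.flatMap_cons, wordVal_append, ih, wordVal_cons, zc]
  have h := checks_mem_centralizer _ (List.mem_append_right _ (List.mem_map.2 ⟨t, ht, rfl⟩))
  rw [wordVal_append, wordVal_append, wordVal_reverse gen_mul_self, wordVal_reverse gen_mul_self,
    hflat] at h
  rw [conj_eq_of_mem_centralizer h, ← zc_eq]

end Conjugates
section DoubleCover

/-- The conjugates of `(abc)⁵`, with a sign. -/
def zs (i : ℕ) : G × ℤˣ := (zc i, -1)

/-- The subgroup of `G × ℤˣ` generated by some of the signed conjugates of `(abc)⁵`. -/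
def signed (ys : List ℕ) : Subgroup (G × ℤˣ) := Subgroup.closure (zs '' {y | y ∈ ys})

lemma zs_mem_signed {ys : List ℕ} {y : ℕ} (hy : y ∈ ys) : zs y ∈ signed ys :=
  Subgroup.subset_closure ⟨y, hy, rfl⟩

lemma zs_mul_self (i : ℕ) : zs i * zs i = 1 := by
  simp [zs, zc_mul_self]

lemma isLookup_signed (ys : List ℕ) :
    IsLookup zs (signed ys) 43 (lookConj ys conjTriples) :=
  isLookup_lookConj zs_mul_self (fun _ => zs_mem_signed) conjTriples_lt fun l hl t ht => by
    simp [zs, ← zc_mul_zc_mul_zc l hl t ht]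

lemma card_signed_le : Finite (signed [18, 37, 31]) ∧ Nat.card (signed [18, 37, 31]) ≤ 351120 := by
  have hE : Finite (signed []) ∧ Nat.card (signed []) ≤ 1 := by
    have : signed [] = ⊥ := by simp [signed]
    rw [this]
    exact ⟨inferInstance, by simp⟩
  obtain ⟨⟨_, h1⟩, -⟩ := scriptE.check_spec zs_mul_self (isLookup_signed []) scriptE_run
    (by decide) (by simp)
  obtain ⟨⟨_, h2⟩, -⟩ := scriptD.check_spec zs_mul_self (isLookup_signed [31]) scriptD_run
    (by decide) (by simp)
  obtain ⟨⟨_, h3⟩, -⟩ := scriptM.check_spec zs_mul_self (isLookup_signed [31, 34]) scriptM_run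
    (by decide) (by simp)
  obtain ⟨⟨_, h4⟩, -⟩ := scriptL.check_spec zs_mul_self (isLookup_signed [31, 34, 39, 19])
    scriptL_run (by decide) (by simp)
  obtain ⟨⟨_, h5⟩, -⟩ := scriptN.check_spec zs_mul_self
    (isLookup_signed [18, 16, 20, 31, 34, 28, 36, 19, 1, 13, 9, 22]) scriptN_run
    (by decide) (by simp)
  exact card_le_of_cover h5 (card_le_of_cover h4 (card_le_of_cover h3
    (card_le_of_cover h2 (card_le_of_cover h1 hE))))

/-- The signed version of the normal closure of `(abc)⁵`. -/
def NS : Subgroup (G × ℤˣ) := signed [18, 37, 31]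

lemma conj_z_mem_NS {t : List ℕ × List ℕ × ℕ} (ht : t ∈ normTriples) :
    (((wordVal gen t.1)⁻¹ * (z * wordVal gen t.1), -1) : G × ℤˣ) ∈ NS := by
  have hmem : ∀ t ∈ normTriples, t.2.2 ∈ [18, 37, 31] ∧ ∀ y ∈ t.2.1, y ∈ [18, 37, 31] := by
    decide
  have hp : wordVal zs t.2.1 ∈ NS := wordVal_mem fun y hy => zs_mem_signed ((hmem t ht).2 y hy)
  have hfst : ∀ l : List ℕ, (wordVal zs l).1 = wordVal zc l := by
    intro l
    induction l with
    | nil => rfl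
    | cons i l ih => rw [wordVal_cons, wordVal_cons, Prod.fst_mul, ih]; rfl
  have := NS.mul_mem (NS.mul_mem (NS.inv_mem hp) (zs_mem_signed (hmem t ht).1)) hp
  rw [conj_z_eq t ht, ← hfst]
  convert this using 1
  ext
  · rfl
  · simp [zs]

lemma z_mem_NS : ((z, -1) : G × ℤˣ) ∈ NS := by
  have h := conj_z_mem_NS (t := ([], [31, 37, 18, 31, 18, 31, 18, 37], 37)) (by decide)
  simpa using h

lemma gen_conj_mem_NS {x : ℕ} (hx : x < 4) {h : G × ℤˣ} (hh : h ∈ NS) :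
    ((gen x, 1) : G × ℤˣ) * h * (gen x, 1) ∈ NS := by
  have hinv : ((gen x, 1) : G × ℤˣ)⁻¹ = (gen x, 1) := by
    rw [Prod.inv_mk, inv_eq_of_mul_eq_one_left (gen_mul_self x), inv_one]
  have hle : NS ≤ NS.comap (MulAut.conj ((gen x, 1) : G × ℤˣ)).toMonoidHom := by
    refine (Subgroup.closure_le _).2 ?_
    rintro _ ⟨y, hy, rfl⟩
    have hmem : ∀ y ∈ [18, 37, 31], ∀ x < 4,
      conjWords.getD y [] ++ [x] ∈ normTriples.map Prod.fst := by decide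
    obtain ⟨t, ht, he⟩ := List.mem_map.1 (hmem y hy x hx)
    have h := conj_z_mem_NS ht
    rw [he, wordVal_append, mul_inv_rev] at h
    have hc := zc_eq y
    change ((gen x, 1) : G × ℤˣ) * zs y * (gen x, 1)⁻¹ ∈ NS
    convert h using 1
    rw [hinv]
    ext
    · simp [zs, hc, mul_assoc, inv_eq_of_mul_eq_one_left (gen_mul_self x)]
    · simp [zs]
  have := hle hh
  change ((gen x, 1) : G × ℤˣ) * h * (gen x, 1)⁻¹ ∈ NS at this
  rwa [hinv] at this

lemma closure_gen_induction {p : G → Prop} (one : p 1)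
    (mul : ∀ x < 4, ∀ g, p g → p (gen x * g)) (g : G) : p g := by
  have hg : g ∈ Subgroup.closure (gen '' {x | x < 4}) := by rw [closure_gen]; trivial
  induction hg using Subgroup.closure_induction_left with
  | one => exact one
  | mul_left y hy g _ ih => obtain ⟨x, hx, rfl⟩ := hy; exact mul x hx g ih
  | inv_mul_cancel y hy g _ ih =>
    obtain ⟨x, hx, rfl⟩ := hy
    rw [inv_eq_of_mul_eq_one_left (gen_mul_self x)]
    exact mul x hx g ih

/-- The elements that lie in `NS` with a positive sign. -/
def E : Subgroup G := NS.comap (MonoidHom.inl G ℤˣ)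

lemma mem_E {g : G} : g ∈ E ↔ ((g, 1) : G × ℤˣ) ∈ NS := Iff.rfl

lemma conj_mem_NS (g : G) {h : G × ℤˣ} (hh : h ∈ NS) :
    ((g, 1) : G × ℤˣ) * h * (g, 1)⁻¹ ∈ NS := by
  induction g using closure_gen_induction with
  | one => simpa [← Prod.one_eq_mk] using hh
  | mul x hx g ih =>
    convert gen_conj_mem_NS hx ih using 1
    ext <;> simp [mul_assoc, inv_eq_of_mul_eq_one_left (gen_mul_self x)]

instance : E.Normal := ⟨fun e he g => by
  simpa [mem_E] using conj_mem_NS g (mem_E.1 he)⟩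

lemma commutator_z_mem_E (g : G) : g * z * g⁻¹ * z ∈ E := by
  have := NS.mul_mem (conj_mem_NS g z_mem_NS) z_mem_NS
  simpa [mem_E] using this

end DoubleCover
section Order

lemma card_quotient_N : Nat.card (G ⧸ N) = 3420 ∧
    ¬ 2 ∣ (Subgroup.closure {gen 0, gen 2} ⊔ N).index := by
  let π : G →* G ⧸ N := QuotientGroup.mk' N
  have hsurj : Function.Surjective π := QuotientGroup.mk'_surjective N
  let g : ℕ → G ⧸ N := fun x => π (gen x)
  have hg : ∀ x, g x * g x = 1 := fun x => by rw [← map_mul, gen_mul_self, map_one]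
  have hword : ∀ l, wordVal g l = π (wordVal gen l) := by
    intro l
    induction l with
    | nil => simp
    | cons x l ih => rw [wordVal_cons, wordVal_cons, map_mul, ih]
  have hrels : ∀ l ∈ relWords, wordVal g l = 1 := fun l hl => by
    rw [hword, wordVal_relWords l hl, map_one]
  have hrelsz : ∀ l ∈ zWord :: relWords, wordVal g l = 1 := by
    rw [List.forall_mem_cons]
    exact ⟨(hword _).trans ((QuotientGroup.eq_one_iff z).2 z_mem_N), hrels⟩
  let W : Subgroup (G ⧸ N) := Subgroup.closure (g '' {y | y ∈ [0, 1, 2]})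
  have hW : Finite W ∧ Nat.card W ≤ 60 := by
    obtain ⟨⟨_, h⟩, -⟩ := scriptW.check_spec hg (isLookup_lookRules (K := ⊥) (loops := []) hg hrelsz
      (by simp) rules_follow) scriptW_run (by decide) (by simp)
    exact card_le_of_cover (k := 1) h ⟨inferInstance, by simp⟩
  have hQ : Finite (G ⧸ N) ∧ Nat.card (G ⧸ N) ≤ 3420 := by
    have hlook : IsLookup g W 4 (lookRules [relRules, zRules, vRules]) := by
      refine isLookup_lookRules (loops := [[0], [1], [2]]) hg hrelsz ?_ ?_
      · have hgen : ∀ x ∈ [0, 1, 2], wordVal g [x] ∈ W := fun x hx => by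
          rw [wordVal_cons, wordVal_nil, mul_one]
          exact Subgroup.subset_closure ⟨x, hx, rfl⟩
        simp only [List.forall_mem_cons]
        exact ⟨hgen 0 (by simp), hgen 1 (by simp), hgen 2 (by simp), by simp⟩
      · have h := rules_follow
        simp only [List.forall_mem_cons] at h ⊢
        exact ⟨fun R hR => (h.1 R hR).mono (by simp) (by simp),
          fun R hR => (h.2.1 R hR).mono (by simp) (by simp),
          fun R hR => (vRules_follow R hR).mono (by simp) (by simp), by simp⟩
    obtain ⟨⟨_, h⟩, -⟩ := scriptQ.check_spec hg hlook scriptQ_run (by decide) (by simp)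
    have htop : Subgroup.closure (g '' {y | y ∈ [0, 1, 2, 3]}) = ⊤ := by
      have h4 : {y | y ∈ [0, 1, 2, 3]} = {x : ℕ | x < 4} := by
        ext x
        simp
        omega
      rw [h4, ← Set.image_image π gen, ← MonoidHom.map_closure, closure_gen,
        Subgroup.map_top_of_surjective π hsurj]
    rw [htop] at h
    obtain ⟨h1, h2⟩ := card_le_of_cover h hW
    rw [Subgroup.card_top] at h2
    exact ⟨Finite.of_equiv _ Subgroup.topEquiv.toEquiv, h2⟩
  have := hQ.1
  obtain ⟨f, hz, hf, h4⟩ := exists_hom_L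
  have hN : N ≤ f.ker := Subgroup.normalClosure_le_normal (by simpa using hz)
  let f' : G ⧸ N →* Equiv.Perm ℕ := QuotientGroup.lift N f hN
  have hcomp : f'.comp π = f := MonoidHom.ext fun _ => rfl
  have hcard : Nat.card (G ⧸ N) = 3420 := by
    refine le_antisymm hQ.2 (Nat.le_of_dvd Nat.card_pos (hf.trans ?_))
    rw [← hcomp, MonoidHom.range_comp, MonoidHom.range_eq_top.2 hsurj, ← MonoidHom.range_eq_map]
    exact Subgroup.card_range_dvd f'
  refine ⟨hcard, ?_⟩
  let H := Subgroup.closure {gen 0, gen 2} ⊔ N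
  have hindex : (H.map π).index = H.index := by
    rw [Subgroup.index_map_eq H hsurj]
    rw [QuotientGroup.ker_mk']
    exact le_sup_right
  have hdvd : 4 ∣ Nat.card (H.map π) := by
    rw [← hcomp, ← Subgroup.map_map] at h4
    exact (h4.trans (Subgroup.card_map_dvd _ _)).trans
      (Subgroup.card_dvd_of_le (Subgroup.map_mono le_sup_left))
  have hmul := (H.map π).card_mul_index
  rw [hcard, hindex] at hmul
  intro h2
  have : 4 * 2 ∣ 3420 := hmul ▸ mul_dvd_mul hdvd h2
  omega

lemma map_eq_one_of_comm {A : Type*} [CommGroup A] (φ : G →* A) : ∀ g, φ g = 1 := by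
  have hsq : ∀ x, φ (gen x) ^ 2 = 1 := fun x => by
    rw [pow_two, ← map_mul, gen_mul_self, map_one]
  have h := fun l hl => congrArg φ (wordVal_relWords l hl)
  have h01 := h [0, 1, 0, 1, 0, 1, 0, 1, 0, 1] (by decide)
  have h12 := h [1, 2, 1, 2, 1, 2] (by decide)
  have h23 := h [2, 3, 2, 3, 2, 3, 2, 3, 2, 3] (by decide)
  have h123 := h [1, 2, 3, 1, 2, 3, 1, 2, 3, 1, 2, 3, 1, 2, 3] (by decide)
  simp only [wordVal_cons, wordVal_nil, mul_one, map_mul, map_one] at h01 h12 h23 h123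
  have hinv : ∀ x, (φ (gen x))⁻¹ = φ (gen x) := fun x =>
    inv_eq_of_mul_eq_one_left (by rw [← pow_two, hsq])
  have heq : ∀ x y k, (φ (gen x) * φ (gen y)) ^ (2 * k + 1) = 1 → φ (gen x) = φ (gen y) := by
    intro x y k hk
    rw [pow_succ, pow_mul, mul_pow, hsq, hsq, one_mul, one_pow, one_mul] at hk
    rw [eq_inv_of_mul_eq_one_left hk, hinv]
  have e01 := heq 0 1 2 (by simpa only [pow_succ, pow_zero, one_mul, mul_assoc] using h01)
  have e12 := heq 1 2 1 (by simpa only [pow_succ, pow_zero, one_mul, mul_assoc] using h12)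
  have e23 := heq 2 3 2 (by simpa only [pow_succ, pow_zero, one_mul, mul_assoc] using h23)
  have e3 : φ (gen 3) = 1 := by
    rw [e12, e23] at h123
    calc φ (gen 3) = (φ (gen 3) ^ 2) ^ 7 * φ (gen 3) := by rw [hsq, one_pow, one_mul]
      _ = 1 := by simpa only [pow_succ, pow_zero, one_mul, mul_assoc] using h123
  have hgen : ∀ x < 4, φ (gen x) = 1 := by
    intro x hx
    interval_cases x
    exacts [(e01.trans e12).trans (e23.trans e3), e12.trans (e23.trans e3), e23.trans e3, e3]
  intro g
  induction g using closure_gen_induction with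
  | one => exact map_one φ
  | mul x hx g ih => rw [map_mul, hgen x hx, ih, one_mul]

open scoped IsMulCommutative in
lemma eq_one_of_odd_index {Q : Type*} [Group Q] {P : Subgroup Q} [IsMulCommutative P]
    (hQ : ∀ φ : Q →* P, φ = 1) (hP : ¬ 2 ∣ P.index) {y : Q} (hy : ∀ g, Commute y g)
    (h2 : y * y = 1) : y = 1 := by
  have : P.FiniteIndex := ⟨fun h => hP (h ▸ dvd_zero 2)⟩
  have h := MonoidHom.transfer_eq_pow (MonoidHom.id P) y fun k g _ => by
    rw [mul_assoc, ((hy g).pow_left k).eq, inv_mul_cancel_left]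
  rw [hQ (MonoidHom.transfer (MonoidHom.id P))] at h
  have h' : y ^ P.index = 1 := (congrArg Subtype.val h).symm
  obtain ⟨k, hk⟩ : Odd P.index := Nat.not_even_iff_odd.1 fun he => hP he.two_dvd
  rwa [hk, pow_succ, pow_mul, pow_two, h2, one_pow, one_mul] at h'

open scoped IsMulCommutative in
lemma z_mem_E : z ∈ E := by
  let π : G →* G ⧸ E := QuotientGroup.mk' E
  have hsurj : Function.Surjective π := QuotientGroup.mk'_surjective E
  have hzz : π z * π z = 1 := by rw [← map_mul, z_mul_self, map_one]
  have hcentral : ∀ g, Commute (π z) g := by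
    intro g
    obtain ⟨g, rfl⟩ := hsurj g
    have h : π (g * z * g⁻¹ * z) = 1 := (QuotientGroup.eq_one_iff _).2 (commutator_z_mem_E g)
    rw [map_mul, map_mul, map_mul, map_inv, mul_eq_one_iff_eq_inv,
      inv_eq_of_mul_eq_one_left hzz, mul_inv_eq_iff_eq_mul] at h
    exact h.symm
  let S : Set (G ⧸ E) := {π (gen 0), π (gen 2), π z}
  have h02 : π (gen 0) * π (gen 2) = π (gen 2) * π (gen 0) := by
    rw [← map_mul, commute_a_c, map_mul]
  have hc : ∀ x ∈ S, ∀ y ∈ S, x * y = y * x := by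
    rintro x (rfl | rfl | rfl) y (rfl | rfl | rfl)
    exacts [rfl, h02, (hcentral _).symm, h02.symm, rfl, (hcentral _).symm, hcentral _, hcentral _,
      rfl]
  have := Subgroup.isMulCommutative_closure hc
  have hle : Subgroup.closure {gen 0, gen 2} ⊔ N ≤ (Subgroup.closure S).comap π := by
    refine sup_le ((Subgroup.closure_le _).2 ?_) ((Subgroup.closure_le _).2 ?_)
    · rintro x (rfl | rfl)
      · exact Subgroup.subset_closure (by simp [S])
      · exact Subgroup.subset_closure (by simp [S])
    · intro x hx
      obtain ⟨y, rfl, hy⟩ := Group.mem_conjugatesOfSet_iff.1 hx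
      obtain ⟨g, rfl⟩ := isConj_iff.1 hy
      change π (g * z * g⁻¹) ∈ Subgroup.closure S
      rw [map_mul, map_mul, map_inv, ← (hcentral (π g)).eq, mul_inv_cancel_right]
      exact Subgroup.subset_closure (by simp [S])
  have hindex : ¬ 2 ∣ (Subgroup.closure S).index := by
    intro h
    rw [← Subgroup.index_comap_of_surjective _ hsurj] at h
    exact card_quotient_N.2 (h.trans (Subgroup.index_dvd_of_le hle))
  refine (QuotientGroup.eq_one_iff z).1 (eq_one_of_odd_index (P := Subgroup.closure S)
    (fun φ => ?_) hindex hcentral hzz)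
  refine MonoidHom.ext fun q => ?_
  obtain ⟨g, rfl⟩ := hsurj q
  exact map_eq_one_of_comm (φ.comp π) g

lemma card_N : Nat.card N = 175560 := by
  have hNE : N ≤ E := Subgroup.normalClosure_le_normal (by simpa using z_mem_E)
  have hle : N.prod (⊤ : Subgroup ℤˣ) ≤ NS := by
    have hsign : ((1, -1) : G × ℤˣ) ∈ NS := by
      simpa [z_mul_self] using NS.mul_mem (mem_E.1 z_mem_E) z_mem_NS
    rintro ⟨g, u⟩ ⟨hg, -⟩
    rcases Int.units_eq_one_or u with rfl | rfl
    · exact mem_E.1 (hNE hg)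
    · simpa using NS.mul_mem (mem_E.1 (hNE hg)) hsign
  have := card_signed_le.1
  have : Finite NS := card_signed_le.1
  have h2 : Nat.card (N.prod (⊤ : Subgroup ℤˣ)) ≤ 351120 :=
    (Subgroup.card_le_of_le hle).trans card_signed_le.2
  rw [Nat.card_congr (Subgroup.prodEquiv N ⊤).toEquiv, Nat.card_prod, Subgroup.card_top,
    Nat.card_eq_fintype_card (α := ℤˣ), Fintype.card_units_int] at h2
  obtain ⟨f, -, ⟨hdvd, -⟩, -⟩ := exists_hom_J
  have : Finite N := Finite.of_injective (fun n : N => (⟨((n : G), 1), mem_E.1 (hNE n.2)⟩ : NS))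
    fun x y h => Subtype.ext (congrArg (fun p : NS => p.1.1) h)
  have := Nat.le_of_dvd Nat.card_pos (hdvd.trans (Subgroup.card_map_dvd _ _))
  omega

end Order

/-- The group presented on `a, b, c, d` with relators `a², b², c², d², (ab)⁵, (bc)³,
`(cd)⁵, (ac)², (ad)², (bd)²` and `(bcd)⁵` has order 600415200. -/
theorem statement_15 : Nat.card G = 600415200 := by
  rw [← N.card_mul_index, card_N, Subgroup.index_eq_card, card_quotient_N.1]

end Stmt15
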